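/- arXiv:math/0507211 — 2 statements merged into one kernel-verified Lean document; each statement's English description precedes it below -/
import Mathlib

section
/- Let f be a Schwartz function on ℝ^d, and for n ≥ 1 let g_n = E_n * f, where E_n(y) = (4πn)^{−d/2} e^{−‖y‖²/(4n)} is the Gauss kernel (so g_n = e^{nΔ} f is the heat semigroup applied to f, with ℱg_n(ξ) = e^{−n‖ξ‖²} ℱf(ξ)). Let λ = inf{ ‖ξ‖ : ξ ∈ supp ℱf } ∈ [0,∞] (inf ∅ = +∞, e^{−∞} := 0). Then for every p ∈ [1,∞], lim_{n→∞} ‖g_n‖_{L^p(ℝ^d)}^{1/n} = e^{−λ²}. In particular, for r > 0, ℱf vanishes identically on the open ball of radius r centered at the origin if and only if lim_{n→∞} ‖g_n‖_{L^p}^{1/n} ≤ e^{−r²}. -/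
open MeasureTheory Filter SchwartzMap
open scoped RealInnerProductSpace ENNReal

noncomputable section

/-- The Gauss kernel `E_n(y) = (4πn)^{-d/2} e^{-‖y‖²/(4n)}`. -/
def GaussK (d : ℕ) (n : ℕ) (y : EuclideanSpace ℝ (Fin d)) : ℝ :=
  (4 * Real.pi * n) ^ (-(d : ℝ) / 2) * Real.exp (-‖y‖ ^ 2 / (4 * n))

/-- The convolution `E_n * f`. -/
def GaussConv {d : ℕ} (n : ℕ) (f : EuclideanSpace ℝ (Fin d) → ℂ) :
    EuclideanSpace ℝ (Fin d) → ℂ :=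
  fun x => ∫ y : EuclideanSpace ℝ (Fin d),
    Complex.ofReal (GaussK d n y) * f (x - y)

/-- The Fourier transform `ℱf(ξ) = ∫ f(x) e^{-i⟨ξ,x⟩} dx`. -/
def FT {d : ℕ} (f : EuclideanSpace ℝ (Fin d) → ℂ)
    (ξ : EuclideanSpace ℝ (Fin d)) : ℂ :=
  ∫ x : EuclideanSpace ℝ (Fin d), f x * Complex.exp (-Complex.I * Complex.ofReal ⟪ξ, x⟫)

/-- `λ = inf { ‖ξ‖ : ξ ∈ supp ℱf } ∈ [0,∞]`, with `inf ∅ = ∞`. -/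
def lamInf {d : ℕ} (f : EuclideanSpace ℝ (Fin d) → ℂ) : ℝ≥0∞ :=
  ⨅ ξ ∈ tsupport (FT f), (‖ξ‖₊ : ℝ≥0∞)

open scoped Classical in
/-- `e^{-λ²} ∈ [0,∞)`, with `e^{-∞} = 0`. -/
def expNegLamSq {d : ℕ} (f : EuclideanSpace ℝ (Fin d) → ℂ) : ℝ≥0∞ :=
  if lamInf f = ⊤ then 0 else ENNReal.ofReal (Real.exp (-(lamInf f).toReal ^ 2))


open scoped FourierTransform

theorem continuous_fourier_integrable {V : Type*} [NormedAddCommGroup V] [InnerProductSpace ℝ V]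
    [FiniteDimensional ℝ V] [MeasurableSpace V] [BorelSpace V] {h : V → ℂ} (hh : Integrable h) :
    Continuous (𝓕 h) :=
  VectorFourier.fourierIntegral_continuous Real.continuous_fourierChar
    (innerSL ℝ).continuous₂ hh

theorem integral_fourier_mul_eq_of_integrable {V : Type*} [NormedAddCommGroup V]
    [InnerProductSpace ℝ V] [FiniteDimensional ℝ V] [MeasurableSpace V] [BorelSpace V]
    {h k : V → ℂ} (hh : Integrable h) (hk : Integrable k) :
    ∫ x, 𝓕 h x * k x = ∫ x, h x * 𝓕 k x := by
  simpa [flip_innerₗ] using! VectorFourier.integral_fourierIntegral_smul_eq_flip (L := innerₗ V)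
    (μ := volume) (ν := volume) Real.continuous_fourierChar continuous_inner hh hk

theorem fourier_eq_FT {d : ℕ} (f : EuclideanSpace ℝ (Fin d) → ℂ) (w : EuclideanSpace ℝ (Fin d)) :
    𝓕 f w = FT f ((2 * Real.pi) • w) := by
  rw [Real.fourier_eq', FT]
  refine integral_congr_ae (Eventually.of_forall fun x => ?_)
  simp only [smul_eq_mul, inner_smul_left, mul_comm (f x), real_inner_comm w x]
  congr 2
  simp
  ring

theorem gaussK_eq_fourier {d n : ℕ} (hn : 1 ≤ n) (y : EuclideanSpace ℝ (Fin d)) :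
    (GaussK d n y : ℂ) = 𝓕 (fun v : EuclideanSpace ℝ (Fin d) =>
      Complex.exp (-((4 * Real.pi ^ 2 * n : ℝ) : ℂ) * ‖v‖ ^ 2)) y := by
  have hn' : (0 : ℝ) < n := by exact_mod_cast hn
  have hb : 0 < (((4 * Real.pi ^ 2 * n : ℝ) : ℂ)).re := by
    rw [Complex.ofReal_re]; positivity
  rw [fourier_gaussian_innerProductSpace hb, GaussK, Complex.ofReal_mul, finrank_euclideanSpace,
    Fintype.card_fin]
  have hpi := Real.pi_pos
  congr 1
  · have h1 : (Real.pi : ℂ) / ((4 * Real.pi ^ 2 * n : ℝ) : ℂ)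
        = ((4 * Real.pi * n)⁻¹ : ℝ) := by
      rw [← Complex.ofReal_div]
      congr 1
      field_simp
    rw [h1, neg_div, Real.rpow_neg (by positivity), ← Real.inv_rpow (by positivity),
      Complex.ofReal_cpow (by positivity)]
    simp
  · rw [Complex.ofReal_exp]
    congr 1
    have : (-(Real.pi : ℂ) ^ 2 * (‖y‖ : ℂ) ^ 2 / ((4 * Real.pi ^ 2 * n : ℝ) : ℂ))
        = ((-Real.pi ^ 2 * ‖y‖ ^ 2 / (4 * Real.pi ^ 2 * n) : ℝ) : ℂ) := by push_cast; ring
    rw [this]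
    congr 1
    field_simp

theorem fourier_comp_sub_left {V : Type*} [NormedAddCommGroup V] [InnerProductSpace ℝ V]
    [FiniteDimensional ℝ V] [MeasurableSpace V] [BorelSpace V] (f : V → ℂ) (x w : V) :
    𝓕 (fun y => f (x - y)) w
      = Complex.exp (((-2 * Real.pi * ⟪w, x⟫ : ℝ) : ℂ) * Complex.I) * 𝓕 f (-w) := by
  simp only [Real.fourier_eq', smul_eq_mul]
  rw [← integral_const_mul, ← integral_sub_left_eq_self _ volume x]
  refine integral_congr_ae (Eventually.of_forall fun y => ?_)
  simp only [sub_sub_cancel, ← mul_assoc, ← Complex.exp_add]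
  congr 2
  simp only [inner_sub_left, inner_neg_right, real_inner_comm w x]
  push_cast
  ring

theorem integrable_gauss_mul_fourier {d : ℕ} (f : 𝓢(EuclideanSpace ℝ (Fin d), ℂ)) (n : ℕ) :
    Integrable (fun w : EuclideanSpace ℝ (Fin d) =>
      Complex.exp (-((4 * Real.pi ^ 2 * n : ℝ) : ℂ) * ‖w‖ ^ 2) * 𝓕 (⇑f) (-w)) := by
  have h1 : Integrable (fun w : EuclideanSpace ℝ (Fin d) => 𝓕 (⇑f) (-w)) :=
    ((𝓕 f : 𝓢(EuclideanSpace ℝ (Fin d), ℂ)).integrable (μ := volume)).comp_neg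
  refine h1.bdd_mul (c := 1) ?_ ?_
  · exact (by fun_prop : Continuous fun w : EuclideanSpace ℝ (Fin d) =>
      Complex.exp (-((4 * Real.pi ^ 2 * n : ℝ) : ℂ) * ‖w‖ ^ 2)).aestronglyMeasurable
  · refine Eventually.of_forall fun w => ?_
    rw [← Complex.ofReal_neg, ← Complex.ofReal_pow, ← Complex.ofReal_mul, Complex.norm_exp,
      Complex.ofReal_re, Real.exp_le_one_iff, neg_mul, neg_nonpos]
    positivity

theorem norm_gauss (a t : ℝ) : ‖Complex.exp (-(a : ℂ) * (t : ℂ) ^ 2)‖ = Real.exp (-(a * t ^ 2)) := by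
  rw [← Complex.ofReal_neg, ← Complex.ofReal_pow, ← Complex.ofReal_mul, Complex.norm_exp,
    Complex.ofReal_re, neg_mul]

theorem gaussConv_eq_fourier {d n : ℕ} (hn : 1 ≤ n) (f : 𝓢(EuclideanSpace ℝ (Fin d), ℂ)) :
    GaussConv n ⇑f = 𝓕 (fun w : EuclideanSpace ℝ (Fin d) =>
      Complex.exp (-((4 * Real.pi ^ 2 * n : ℝ) : ℂ) * ‖w‖ ^ 2) * 𝓕 (⇑f) (-w)) := by
  funext x
  have hn' : (0 : ℝ) < n := by exact_mod_cast hn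
  have hG : Integrable (fun v : EuclideanSpace ℝ (Fin d) =>
      Complex.exp (-((4 * Real.pi ^ 2 * n : ℝ) : ℂ) * ‖v‖ ^ 2)) := by
    have hb : 0 < (((4 * Real.pi ^ 2 * n : ℝ) : ℂ)).re := by
      rw [Complex.ofReal_re]; have := Real.pi_pos; positivity
    simpa using GaussianFourier.integrable_cexp_neg_mul_sq_norm_add hb 0
      (0 : EuclideanSpace ℝ (Fin d))
  have hf : Integrable (fun y => f (x - y)) := (f.integrable (μ := volume)).comp_sub_left x
  simp only [GaussConv, gaussK_eq_fourier hn]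
  rw [integral_fourier_mul_eq_of_integrable hG hf, Real.fourier_eq']
  refine integral_congr_ae (Eventually.of_forall fun w => ?_)
  simp only [fourier_comp_sub_left, smul_eq_mul]
  ring

theorem norm_gaussConv_le {d n : ℕ} (hn : 1 ≤ n) (f : 𝓢(EuclideanSpace ℝ (Fin d), ℂ)) {l : ℝ}
    (hl0 : 0 ≤ l) (hl : ∀ ξ, FT (⇑f) ξ ≠ 0 → l ≤ ‖ξ‖) (x : EuclideanSpace ℝ (Fin d)) :
    ‖GaussConv n (⇑f) x‖ ≤ (∫ w, ‖𝓕 (⇑f) w‖) * Real.exp (-(n * l ^ 2)) := by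
  have hpi := Real.pi_pos
  have h1 : Integrable (fun w : EuclideanSpace ℝ (Fin d) => 𝓕 (⇑f) (-w)) :=
    ((𝓕 f : 𝓢(EuclideanSpace ℝ (Fin d), ℂ)).integrable (μ := volume)).comp_neg
  rw [gaussConv_eq_fourier hn, Real.fourier_eq, ← integral_neg_eq_self (fun w => ‖𝓕 (⇑f) w‖) volume,
    ← integral_mul_const]
  refine norm_integral_le_of_norm_le (h1.norm.mul_const _) (Eventually.of_forall fun w => ?_)
  rw [Circle.norm_smul, norm_mul, norm_gauss, mul_comm]
  by_cases hw : 𝓕 (⇑f) (-w) = 0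
  · simp [hw]
  have := hl _ (by rwa [fourier_eq_FT] at hw)
  rw [norm_smul, norm_neg, Real.norm_of_nonneg (by positivity)] at this
  refine mul_le_mul_of_nonneg_left (Real.exp_le_exp.2 (neg_le_neg ?_)) (norm_nonneg _)
  calc (n : ℝ) * l ^ 2 ≤ n * (2 * Real.pi * ‖w‖) ^ 2 := by gcongr
    _ = _ := by ring

theorem exp_neg_sq_div_mul_pow_le {n : ℕ} (hn : 1 ≤ n) (k : ℕ) {t : ℝ} (ht : 0 ≤ t) :
    Real.exp (-t ^ 2 / (4 * n)) * (1 + t) ^ k ≤ Real.exp 2 * k.factorial * n ^ k := by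
  have hn' : (1 : ℝ) ≤ n := by exact_mod_cast hn
  have h1 : ((1 + t) / n) ^ k ≤ k.factorial * Real.exp ((1 + t) / n) := by
    have := Real.pow_div_factorial_le_exp ((1 + t) / n) (by positivity) k
    rwa [div_le_iff₀ (by positivity), mul_comm] at this
  have h2 : -t ^ 2 / (4 * n) ≤ 2 - (1 + t) / n := by
    rw [div_le_iff₀ (by positivity)]
    have : (2 - (1 + t) / n) * (4 * n) = 8 * n - 4 * (1 + t) := by
      field_simp
      ring
    rw [this]
    nlinarith [sq_nonneg (t - 2)]
  calc Real.exp (-t ^ 2 / (4 * n)) * (1 + t) ^ k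
      = Real.exp (-t ^ 2 / (4 * n)) * (((1 + t) / n) ^ k * n ^ k) := by
        rw [← mul_pow]; congr 2; field_simp
    _ ≤ Real.exp (2 - (1 + t) / n) * ((k.factorial * Real.exp ((1 + t) / n)) * n ^ k) := by gcongr
    _ = Real.exp 2 * k.factorial * n ^ k := by
        rw [Real.exp_sub]; field_simp

theorem gaussK_nonneg (d n : ℕ) (y : EuclideanSpace ℝ (Fin d)) : 0 ≤ GaussK d n y := by
  have := Real.pi_pos
  unfold GaussK
  positivity

theorem gaussK_mul_pow_le {d n : ℕ} (hn : 1 ≤ n) (k : ℕ) (y : EuclideanSpace ℝ (Fin d)) :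
    GaussK d n y * (1 + ‖y‖) ^ k ≤ Real.exp 2 * k.factorial * n ^ k := by
  have hn' : (1 : ℝ) ≤ n := by exact_mod_cast hn
  have hpi := Real.pi_gt_three
  have h1 : (4 * Real.pi * n) ^ (-(d : ℝ) / 2) ≤ 1 := by
    refine Real.rpow_le_one_of_one_le_of_nonpos (by nlinarith) ?_
    have : (0 : ℝ) ≤ d := by positivity
    linarith
  refine le_trans ?_ (exp_neg_sq_div_mul_pow_le hn k (norm_nonneg y))
  unfold GaussK
  gcongr
  exact mul_le_of_le_one_left (Real.exp_nonneg _) h1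

theorem exists_pow_mul_norm_le {V : Type*} [NormedAddCommGroup V] [NormedSpace ℝ V]
    (f : 𝓢(V, ℂ)) (N : ℕ) : ∃ C, 0 ≤ C ∧ ∀ x, (1 + ‖x‖) ^ N * ‖f x‖ ≤ C := by
  refine ⟨2 ^ N * ((Finset.Iic (N, 0)).sup fun m => SchwartzMap.seminorm ℝ m.1 m.2) f,
    by positivity, fun x => ?_⟩
  simpa using SchwartzMap.one_add_le_sup_seminorm_apply (𝕜 := ℝ) (m := (N, 0)) le_rfl le_rfl f x

theorem integrable_inv_one_add_norm_pow (d : ℕ) :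
    Integrable (fun x : EuclideanSpace ℝ (Fin d) => ((1 + ‖x‖) ^ (d + 1))⁻¹) := by
  have := integrable_one_add_norm (E := EuclideanSpace ℝ (Fin d)) (μ := volume) (r := (d + 1 : ℕ))
    (by simp)
  refine this.congr (Eventually.of_forall fun x => ?_)
  simp only
  rw [Real.rpow_neg (by positivity), Real.rpow_natCast]

theorem memLp_inv_one_add_norm_pow (d : ℕ) {p : ℝ≥0∞} (hp : 1 ≤ p) :
    MemLp (fun x : EuclideanSpace ℝ (Fin d) => ((1 + ‖x‖) ^ (d + 1))⁻¹) p := by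
  have hc : Continuous (fun x : EuclideanSpace ℝ (Fin d) => ((1 + ‖x‖) ^ (d + 1))⁻¹) :=
    Continuous.inv₀ (by fun_prop) fun x => by positivity
  rcases eq_or_ne p ⊤ with rfl | hpt
  · refine memLp_top_of_bound hc.aestronglyMeasurable 1 (Eventually.of_forall fun x => ?_)
    rw [Real.norm_of_nonneg (by positivity)]
    exact inv_le_one_of_one_le₀ (one_le_pow₀ (by simp))
  · have hp1 : 1 ≤ p.toReal := by
      rw [← ENNReal.toReal_one]; exact ENNReal.toReal_mono hpt hp
    rw [← integrable_norm_rpow_iff hc.aestronglyMeasurable (by positivity) hpt]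
    refine (integrable_inv_one_add_norm_pow d).mono'
      (by exact (hc.norm.rpow_const (by intro; right; positivity)).aestronglyMeasurable)
      (Eventually.of_forall fun x => ?_)
    rw [Real.norm_of_nonneg (by positivity), Real.norm_of_nonneg (by positivity)]
    exact Real.rpow_le_self_of_le_one (by positivity)
      (inv_le_one_of_one_le₀ (one_le_pow₀ (by simp))) hp1

theorem exists_norm_gaussConv_mul_pow_le {d : ℕ} (f : 𝓢(EuclideanSpace ℝ (Fin d), ℂ)) (N : ℕ) :
    ∃ C, 0 ≤ C ∧ ∃ k : ℕ, ∀ n : ℕ, 1 ≤ n → ∀ x,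
      ‖GaussConv n (⇑f) x‖ * (1 + ‖x‖) ^ N ≤ C * n ^ k := by
  obtain ⟨M, hM0, hM⟩ := exists_pow_mul_norm_le f N
  set W := ∫ y : EuclideanSpace ℝ (Fin d), ((1 + ‖y‖) ^ (d + 1))⁻¹ with hW
  have hW0 : 0 ≤ W := integral_nonneg fun y => by positivity
  set k := N + (d + 1) with hk
  refine ⟨Real.exp 2 * k.factorial * M * W, by positivity, k, fun n hn x => ?_⟩
  have key : ‖GaussConv n (⇑f) x‖
      ≤ ∫ y : EuclideanSpace ℝ (Fin d), (Real.exp 2 * k.factorial * n ^ k * M / (1 + ‖x‖) ^ N) *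
        ((1 + ‖y‖) ^ (d + 1))⁻¹ := by
    refine norm_integral_le_of_norm_le ((integrable_inv_one_add_norm_pow d).const_mul _)
      (Eventually.of_forall fun y => ?_)
    rw [norm_mul, Complex.norm_real, Real.norm_of_nonneg (gaussK_nonneg d n y),
      ← div_eq_mul_inv, le_div_iff₀ (by positivity), le_div_iff₀ (by positivity)]
    have h1 : 1 + ‖x‖ ≤ (1 + ‖y‖) * (1 + ‖x - y‖) := by
      have := norm_add_le y (x - y)
      rw [add_sub_cancel] at this
      nlinarith [mul_nonneg (norm_nonneg y) (norm_nonneg (x - y))]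
    have h0 := gaussK_nonneg d n y
    calc GaussK d n y * ‖f (x - y)‖ * (1 + ‖y‖) ^ (d + 1) * (1 + ‖x‖) ^ N
        ≤ GaussK d n y * ‖f (x - y)‖ * (1 + ‖y‖) ^ (d + 1) *
          ((1 + ‖y‖) * (1 + ‖x - y‖)) ^ N := by gcongr
      _ = (GaussK d n y * (1 + ‖y‖) ^ k) * ((1 + ‖x - y‖) ^ N * ‖f (x - y)‖) := by
          rw [hk, mul_pow, pow_add]; ring
      _ ≤ (Real.exp 2 * k.factorial * n ^ k) * M :=
          mul_le_mul (gaussK_mul_pow_le hn k y) (hM _) (by positivity) (by positivity)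
  rw [integral_const_mul, ← hW] at key
  calc ‖GaussConv n (⇑f) x‖ * (1 + ‖x‖) ^ N
      ≤ (Real.exp 2 * k.factorial * n ^ k * M / (1 + ‖x‖) ^ N) * W * (1 + ‖x‖) ^ N := by gcongr
    _ = _ := by field_simp

theorem exists_eLpNorm_gaussConv_le {d : ℕ} (f : 𝓢(EuclideanSpace ℝ (Fin d), ℂ)) {p : ℝ≥0∞}
    (hp : 1 ≤ p) {l : ℝ} (hl0 : 0 ≤ l) (hl : ∀ ξ, FT (⇑f) ξ ≠ 0 → l ≤ ‖ξ‖) (j : ℕ) :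
    ∃ C, 0 < C ∧ ∃ k : ℕ, ∀ n : ℕ, 1 ≤ n →
      eLpNorm (GaussConv n ⇑f) p volume
        ≤ ENNReal.ofReal (C * n ^ k * Real.exp (-(n * (l ^ 2 * (j / (j + 1)))))) := by
  obtain ⟨B, hB0, k, hB⟩ := exists_norm_gaussConv_mul_pow_le f ((d + 1) * (j + 1))
  set A := ∫ w, ‖𝓕 (⇑f) w‖ with hA
  have hA0 : 0 ≤ A := integral_nonneg fun _ => norm_nonneg _
  set w : EuclideanSpace ℝ (Fin d) → ℝ := fun x => ((1 + ‖x‖) ^ (d + 1))⁻¹ with hw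
  have hwp := (memLp_inv_one_add_norm_pow d hp).2
  set S := (eLpNorm w p volume).toReal with hS
  refine ⟨(1 + A + B) * (S + 1), by positivity, k, fun n hn => ?_⟩
  have hn' : (1 : ℝ) ≤ n := by exact_mod_cast hn
  have hnk : (1 : ℝ) ≤ (n : ℝ) ^ k := one_le_pow₀ hn'
  set D := (1 + A + B) * n ^ k * Real.exp (-(n * (l ^ 2 * (j / (j + 1))))) with hD
  have hpt : ∀ x, ‖GaussConv n (⇑f) x‖ ≤ D * ‖w x‖ := by
    intro x
    have h1 := norm_gaussConv_le hn f hl0 hl x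
    have h2 : ‖GaussConv n (⇑f) x‖ ≤ B * n ^ k * w x ^ (j + 1) := by
      have := hB n hn x
      rw [hw]
      simp only [inv_pow, ← pow_mul]
      rwa [← div_eq_mul_inv, le_div_iff₀ (by positivity)]
    have hw0 : 0 ≤ w x := by simp only [hw]; positivity
    rw [Real.norm_of_nonneg hw0]
    refine le_of_pow_le_pow_left₀ (Nat.succ_ne_zero j) (by positivity) ?_
    calc ‖GaussConv n (⇑f) x‖ ^ (j + 1)
        = ‖GaussConv n (⇑f) x‖ ^ j * ‖GaussConv n (⇑f) x‖ := pow_succ _ _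
      _ ≤ (A * Real.exp (-(n * l ^ 2))) ^ j * (B * n ^ k * w x ^ (j + 1)) := by gcongr
      _ ≤ ((1 + A + B) * n ^ k * Real.exp (-(n * l ^ 2))) ^ j *
          ((1 + A + B) * n ^ k * w x ^ (j + 1)) := by
          gcongr
          · nlinarith
          · linarith
      _ = (D * w x) ^ (j + 1) := by
          have h3 : Real.exp (-(n * l ^ 2)) ^ j
              = Real.exp (-(n * (l ^ 2 * (j / (j + 1))))) ^ (j + 1) := by
            rw [← Real.exp_nat_mul, ← Real.exp_nat_mul]
            congr 1
            push_cast
            field_simp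
          rw [hD]
          simp only [mul_pow]
          rw [h3]
          ring
  refine (eLpNorm_le_mul_eLpNorm_of_ae_le_mul (Eventually.of_forall hpt) p).trans ?_
  rw [← ENNReal.ofReal_toReal hwp.ne, ← ENNReal.ofReal_mul (by positivity)]
  refine ENNReal.ofReal_le_ofReal ?_
  calc D * S ≤ D * (S + 1) := by gcongr; linarith
    _ = _ := by rw [hD]; ring

theorem exists_le_eLpNorm_gaussConv {d : ℕ} (f : 𝓢(EuclideanSpace ℝ (Fin d), ℂ)) {p : ℝ≥0∞}
    (hp : 1 ≤ p) {ξ : EuclideanSpace ℝ (Fin d)} (hξ : FT (⇑f) ξ ≠ 0) {μ : ℝ}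
    (hμ : ‖ξ‖ ^ 2 < μ) :
    ∃ c, 0 < c ∧ ∀ n : ℕ, 1 ≤ n →
      ENNReal.ofReal (c * Real.exp (-(n * μ))) ≤ eLpNorm (GaussConv n ⇑f) p volume := by
  have hpi := Real.pi_pos
  set w₀ : EuclideanSpace ℝ (Fin d) := -((2 * Real.pi)⁻¹ • ξ) with hw₀
  set H : EuclideanSpace ℝ (Fin d) → ℂ := fun w => 𝓕 (⇑f) (-w) with hH
  have hHc : Continuous H := (continuous_fourier_integrable f.integrable).comp continuous_neg
  have hH0 : H w₀ ≠ 0 := by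
    rw [hH]
    simp only [hw₀, neg_neg, fourier_eq_FT, smul_smul]
    rwa [mul_inv_cancel₀ (by positivity), one_smul]
  have hn0 : 0 < ‖H w₀‖ := norm_pos_iff.2 hH0
  have hnear : ∀ᶠ w in nhds w₀, ‖H w₀‖ ^ 2 / 2 < ((starRingEnd ℂ) (H w₀) * H w).re ∧
      4 * Real.pi ^ 2 * ‖w‖ ^ 2 < μ := by
    refine Filter.Eventually.and ?_ ?_
    · have hc : Continuous fun w => ((starRingEnd ℂ) (H w₀) * H w).re := by fun_prop
      refine (hc.tendsto w₀).eventually_const_lt ?_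
      rw [Complex.conj_mul', ← Complex.ofReal_pow, Complex.ofReal_re]
      nlinarith [pow_pos hn0 2]
    · have hc : Continuous fun w : EuclideanSpace ℝ (Fin d) => 4 * Real.pi ^ 2 * ‖w‖ ^ 2 := by
        fun_prop
      refine (hc.tendsto w₀).eventually_lt_const ?_
      rw [hw₀, norm_neg, norm_smul, Real.norm_of_nonneg (by positivity)]
      calc _ = ‖ξ‖ ^ 2 := by field_simp; ring
        _ < μ := hμ
  obtain ⟨δ, hδ, hball⟩ := Metric.eventually_nhds_iff_ball.1 hnear
  let b : ContDiffBump w₀ := ⟨δ / 2, δ, by positivity, by linarith⟩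
  have hbs : ∀ w, b w ≠ 0 → w ∈ Metric.ball w₀ δ := fun w hw => by
    have : w ∈ Function.support b := hw
    rwa [b.support_eq] at this
  let φ : 𝓢(EuclideanSpace ℝ (Fin d), ℂ) :=
    HasCompactSupport.toSchwartzMap (f := fun w => ((b w : ℝ) : ℂ))
      (b.hasCompactSupport.comp_left Complex.ofReal_zero)
      (Complex.ofRealCLM.contDiff.comp b.contDiff)
  have hφ : ∀ w, φ w = ((b w : ℝ) : ℂ) := fun w => rfl
  set ψ : 𝓢(EuclideanSpace ℝ (Fin d), ℂ) := 𝓕⁻ φ with hψ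
  have hψφ : 𝓕 (⇑ψ) = ⇑φ := by
    rw [← SchwartzMap.fourier_coe, hψ, FourierTransform.fourier_fourierInv_eq]
  have hbint : Integrable (fun w => b w) := b.integrable
  have hbpos : 0 < ∫ w, b w := b.integral_pos
  have : Fact (1 ≤ p) := ⟨hp⟩
  set q := ENNReal.conjExponent p
  have hψq := (ψ.memLp q volume).2
  set S := (eLpNorm ψ q volume).toReal with hS
  set c := (‖H w₀‖ ^ 2 / 2 * ∫ w, b w) / ‖H w₀‖ / (S + 1) with hc
  have hcpos : 0 < c := by positivity
  refine ⟨c, hcpos, fun n hn => ?_⟩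
  set K : EuclideanSpace ℝ (Fin d) → ℂ := fun w =>
    Complex.exp (-((4 * Real.pi ^ 2 * n : ℝ) : ℂ) * ‖w‖ ^ 2) * H w with hK
  have hKi : Integrable K := integrable_gauss_mul_fourier f n
  have hg : GaussConv n ⇑f = 𝓕 K := gaussConv_eq_fourier hn f
  have hpair : ∫ x, GaussConv n (⇑f) x * ψ x = ∫ w, K w * φ w := by
    rw [hg, integral_fourier_mul_eq_of_integrable hKi ψ.integrable, hψφ]
  have hKφ : Integrable fun w => K w * φ w := by
    have := hKi.bdd_mul (c := 1) φ.continuous.aestronglyMeasurable (Eventually.of_forall fun w => by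
      rw [hφ, Complex.norm_real, Real.norm_of_nonneg b.nonneg]; exact b.le_one)
    simpa only [mul_comm] using this
  have hlow : Real.exp (-(n * μ)) * (‖H w₀‖ ^ 2 / 2 * ∫ w, b w)
      ≤ ‖H w₀‖ * ‖∫ x, GaussConv n (⇑f) x * ψ x‖ := by
    have hconj : ∀ z, ‖H w₀‖ * ‖z‖ = ‖(starRingEnd ℂ) (H w₀) * z‖ := fun z => by
      rw [norm_mul, RCLike.norm_conj]
    rw [hpair, hconj, ← integral_const_mul, ← integral_const_mul, ← integral_const_mul]
    refine le_trans ?_ (Complex.re_le_norm _)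
    have hre : (∫ w, (starRingEnd ℂ) (H w₀) * (K w * φ w)).re
        = ∫ w, ((starRingEnd ℂ) (H w₀) * (K w * φ w)).re :=
      (integral_re (hKφ.const_mul _)).symm
    rw [hre]
    refine integral_mono ((hbint.const_mul _).const_mul _) (hKφ.const_mul _).re fun w => ?_
    have hval : ((starRingEnd ℂ) (H w₀) * (K w * φ w)).re
        = Real.exp (-(4 * Real.pi ^ 2 * n * ‖w‖ ^ 2)) * b w *
          ((starRingEnd ℂ) (H w₀) * H w).re := by
      rw [← Complex.re_ofReal_mul, hK, hφ]
      congr 1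
      push_cast
      simp only [neg_mul]
      ring
    simp only [hval]
    by_cases hw : b w = 0
    · simp [hw]
    obtain ⟨h1, h2⟩ := hball w (hbs w hw)
    have hb0 : 0 ≤ b w := b.nonneg
    calc Real.exp (-(n * μ)) * (‖H w₀‖ ^ 2 / 2 * b w)
        = Real.exp (-(n * μ)) * b w * (‖H w₀‖ ^ 2 / 2) := by ring
      _ ≤ _ := by
        have : (4 * Real.pi ^ 2 * n * ‖w‖ ^ 2) ≤ n * μ := by
          calc (4 * Real.pi ^ 2 * n * ‖w‖ ^ 2) = n * (4 * Real.pi ^ 2 * ‖w‖ ^ 2) := by ring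
            _ ≤ _ := by gcongr
        gcongr
  have hhol : ENNReal.ofReal ‖∫ x, GaussConv n (⇑f) x * ψ x‖
      ≤ eLpNorm (GaussConv n ⇑f) p volume * ENNReal.ofReal (S + 1) := by
    have hgm : AEStronglyMeasurable (GaussConv n ⇑f) volume := by
      rw [hg]; exact (continuous_fourier_integrable hKi).aestronglyMeasurable
    calc ENNReal.ofReal ‖∫ x, GaussConv n (⇑f) x * ψ x‖
        ≤ eLpNorm (GaussConv n ⇑f • ⇑ψ) 1 volume := by
          rw [ofReal_norm, eLpNorm_one_eq_lintegral_enorm]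
          exact enorm_integral_le_lintegral_enorm _
      _ ≤ eLpNorm (GaussConv n ⇑f) p volume * eLpNorm ψ q volume :=
          eLpNorm_smul_le_mul_eLpNorm ψ.continuous.aestronglyMeasurable hgm
      _ ≤ _ := by
          gcongr
          rw [← ENNReal.ofReal_toReal hψq.ne]
          exact ENNReal.ofReal_le_ofReal (by linarith)
  have hS1 : 0 < S + 1 := by positivity
  refine (ENNReal.mul_le_mul_iff_left (c := ENNReal.ofReal (S + 1)) (by simpa using hS1)
    ENNReal.ofReal_ne_top).1 (le_trans ?_ hhol)
  rw [← ENNReal.ofReal_mul (by positivity)]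
  refine ENNReal.ofReal_le_ofReal ?_
  rw [hc]
  calc _ = Real.exp (-(n * μ)) * (‖H w₀‖ ^ 2 / 2 * ∫ w, b w) / ‖H w₀‖ := by field_simp
    _ ≤ _ := by rw [div_le_iff₀ hn0, mul_comm ‖∫ x, _‖]; exact hlow

theorem tendsto_root_mul_pow_mul_exp {C : ℝ} (hC : 0 < C) (k : ℕ) (μ : ℝ) :
    Tendsto (fun n : ℕ => ENNReal.ofReal (C * n ^ k * Real.exp (-(n * μ))) ^ (1 / (n : ℝ)))
      atTop (nhds (ENNReal.ofReal (Real.exp (-μ)))) := by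
  have h1 : Tendsto (fun n : ℕ => C ^ (1 / (n : ℝ))) atTop (nhds 1) := by
    have := (Real.continuousAt_const_rpow (b := 0) hC.ne').tendsto.comp
      (tendsto_one_div_atTop_nhds_zero_nat (𝕜 := ℝ))
    simpa [Function.comp_def] using this
  have h2 : Tendsto (fun n : ℕ => ((n : ℝ) ^ (1 / (n : ℝ))) ^ k) atTop (nhds 1) := by
    simpa using (tendsto_rpow_div.comp (tendsto_natCast_atTop_atTop (R := ℝ))).pow k
  have h3 := ENNReal.tendsto_ofReal ((h1.mul h2).mul_const (Real.exp (-μ)))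
  rw [one_mul, one_mul] at h3
  refine h3.congr' ?_
  filter_upwards [eventually_ge_atTop 1] with n hn
  have hn' : (0 : ℝ) < n := by exact_mod_cast hn
  rw [ENNReal.ofReal_rpow_of_pos (by positivity), Real.mul_rpow (by positivity) (by positivity),
    Real.mul_rpow (by positivity) (by positivity), ← Real.exp_mul, ← Real.rpow_natCast,
    ← Real.rpow_natCast, ← Real.rpow_mul hn'.le, ← Real.rpow_mul hn'.le]
  congr 3
  · rw [mul_comm]
  · field_simp

theorem lamInf_le_norm_of_FT_ne_zero {d : ℕ} {f : EuclideanSpace ℝ (Fin d) → ℂ}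
    {ξ : EuclideanSpace ℝ (Fin d)} (hξ : FT f ξ ≠ 0) : lamInf f ≤ ENNReal.ofReal ‖ξ‖ := by
  rw [ofReal_norm]
  exact iInf₂_le ξ (subset_tsupport _ hξ)

theorem exists_FT_ne_zero_of_lamInf_lt {d : ℕ} {f : EuclideanSpace ℝ (Fin d) → ℂ} {r : ℝ≥0∞}
    (h : lamInf f < r) : ∃ ξ, FT f ξ ≠ 0 ∧ ENNReal.ofReal ‖ξ‖ < r := by
  simp only [lamInf, iInf_lt_iff] at h
  obtain ⟨ξ, hξ, hr⟩ := h
  have ho : IsOpen {η : EuclideanSpace ℝ (Fin d) | (‖η‖₊ : ℝ≥0∞) < r} :=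
    isOpen_lt (by fun_prop) continuous_const
  obtain ⟨η, h1, h2⟩ := mem_closure_iff.1 hξ _ ho hr
  exact ⟨η, h2, by rw [ofReal_norm]; exact h1⟩

theorem tendsto_root_eLpNorm_gaussConv {d : ℕ} (f : 𝓢(EuclideanSpace ℝ (Fin d), ℂ)) {p : ℝ≥0∞}
    (hp : 1 ≤ p) :
    Tendsto (fun n : ℕ => (eLpNorm (GaussConv n ⇑f) p volume) ^ (1 / (n : ℝ)))
      atTop (nhds (expNegLamSq ⇑f)) := by
  unfold expNegLamSq
  split_ifs with htop
  · refine tendsto_const_nhds.congr' ?_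
    filter_upwards [eventually_ge_atTop 1] with n hn
    have hn' : (0 : ℝ) < n := by exact_mod_cast hn
    have h0 : 𝓕 (⇑f) = 0 := by
      funext w
      rw [fourier_eq_FT]
      by_contra hw
      have := lamInf_le_norm_of_FT_ne_zero hw
      rw [htop, top_le_iff] at this
      exact ENNReal.ofReal_ne_top this
    have hg : GaussConv n ⇑f = 0 := by
      rw [gaussConv_eq_fourier hn, h0]
      funext x
      simp [Real.fourier_eq]
    rw [hg, eLpNorm_zero, ENNReal.zero_rpow_of_pos (by positivity)]
  set l := (lamInf ⇑f).toReal with hl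
  have hl' : lamInf ⇑f = ENNReal.ofReal l := (ENNReal.ofReal_toReal htop).symm
  have hl0 : 0 ≤ l := ENNReal.toReal_nonneg
  have hle : ∀ ξ, FT (⇑f) ξ ≠ 0 → l ≤ ‖ξ‖ := fun ξ hξ => by
    have := ENNReal.toReal_mono ENNReal.ofReal_ne_top (lamInf_le_norm_of_FT_ne_zero hξ)
    simpa using this
  rw [tendsto_order]
  constructor
  · intro a ha
    obtain ⟨ε, hε, hμ⟩ : ∃ ε > 0, a < ENNReal.ofReal (Real.exp (-(l + ε) ^ 2 - ε)) := by
      have hc : Continuous fun ε : ℝ => ENNReal.ofReal (Real.exp (-(l + ε) ^ 2 - ε)) :=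
        ENNReal.continuous_ofReal.comp (by fun_prop)
      have h1 : ∀ᶠ ε in nhds (0 : ℝ), a < ENNReal.ofReal (Real.exp (-(l + ε) ^ 2 - ε)) :=
        (hc.tendsto 0).eventually_const_lt (by simpa using ha)
      obtain ⟨ε, h2, h3⟩ := ((h1.filter_mono nhdsWithin_le_nhds).and
        (self_mem_nhdsWithin (s := Set.Ioi (0 : ℝ)))).exists
      exact ⟨ε, h3, h2⟩
    obtain ⟨ξ, hξ, hξr⟩ := exists_FT_ne_zero_of_lamInf_lt (f := ⇑f) (r := ENNReal.ofReal (l + ε))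
      (by rw [hl']; exact (ENNReal.ofReal_lt_ofReal_iff (by linarith)).2 (by linarith))
    have hξr' : ‖ξ‖ < l + ε :=
      (ENNReal.ofReal_lt_ofReal_iff (by linarith)).1 hξr
    have hlt : ‖ξ‖ ^ 2 < (l + ε) ^ 2 + ε := by nlinarith [norm_nonneg ξ]
    obtain ⟨c, hc, hcn⟩ := exists_le_eLpNorm_gaussConv f hp hξ hlt
    have ht := tendsto_root_mul_pow_mul_exp hc 0 ((l + ε) ^ 2 + ε)
    rw [neg_add'] at ht
    filter_upwards [ht.eventually_const_lt hμ, eventually_ge_atTop 1] with n h1 hn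
    refine h1.trans_le (ENNReal.rpow_le_rpow ?_ (by positivity))
    simpa using hcn n hn
  · intro a ha
    obtain ⟨j, hj⟩ : ∃ j : ℕ, ENNReal.ofReal (Real.exp (-(l ^ 2 * (j / (j + 1))))) < a := by
      have h1 : Tendsto (fun j : ℕ => ENNReal.ofReal (Real.exp (-(l ^ 2 * ((j : ℝ) / (j + 1))))))
          atTop (nhds (ENNReal.ofReal (Real.exp (-(l ^ 2 * 1))))) :=
        ENNReal.tendsto_ofReal ((Real.continuous_exp.tendsto _).comp
          ((tendsto_natCast_div_add_atTop (1 : ℝ)).const_mul _).neg)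
      exact (h1.eventually_lt_const (by simpa using ha)).exists
    obtain ⟨C, hC, k, hCn⟩ := exists_eLpNorm_gaussConv_le f hp hl0 hle j
    filter_upwards [(tendsto_root_mul_pow_mul_exp hC k _).eventually_lt_const hj,
      eventually_ge_atTop 1] with n h1 hn
    exact (ENNReal.rpow_le_rpow (hCn n hn) (by positivity)).trans_lt h1

theorem FT_eq_zero_on_ball_iff {d : ℕ} (f : EuclideanSpace ℝ (Fin d) → ℂ) {r : ℝ} (hr : 0 < r) :
    (∀ ξ ∈ Metric.ball (0 : EuclideanSpace ℝ (Fin d)) r, FT f ξ = 0) ↔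
      ENNReal.ofReal r ≤ lamInf f := by
  constructor
  · intro h
    by_contra! hlt
    obtain ⟨ξ, hξ, hξr⟩ := exists_FT_ne_zero_of_lamInf_lt hlt
    refine hξ (h ξ ?_)
    simpa using (ENNReal.ofReal_lt_ofReal_iff hr).1 hξr
  · intro h ξ hξ
    by_contra hne
    have := h.trans (lamInf_le_norm_of_FT_ne_zero hne)
    rw [ENNReal.ofReal_le_ofReal_iff (norm_nonneg _)] at this
    simp at hξ
    linarith

theorem expNegLamSq_le_iff {d : ℕ} (f : EuclideanSpace ℝ (Fin d) → ℂ) {r : ℝ} (hr : 0 < r) :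
    expNegLamSq f ≤ ENNReal.ofReal (Real.exp (-r ^ 2)) ↔ ENNReal.ofReal r ≤ lamInf f := by
  unfold expNegLamSq
  split_ifs with htop
  · simp [htop]
  · rw [ENNReal.ofReal_le_ofReal_iff (Real.exp_nonneg _), Real.exp_le_exp, neg_le_neg_iff,
      pow_le_pow_iff_left₀ hr.le ENNReal.toReal_nonneg two_ne_zero,
      ENNReal.ofReal_le_iff_le_toReal htop]

theorem stmt11 (d : ℕ) (f : 𝓢(EuclideanSpace ℝ (Fin d), ℂ))
    (p : ℝ≥0∞) (hp : 1 ≤ p) :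
    Tendsto (fun n : ℕ => (eLpNorm (GaussConv n ⇑f) p volume) ^ (1 / (n : ℝ)))
      atTop (nhds (expNegLamSq ⇑f)) ∧
    ∀ r : ℝ, 0 < r →
      ((∀ ξ ∈ Metric.ball (0 : EuclideanSpace ℝ (Fin d)) r, FT (⇑f) ξ = 0) ↔
        expNegLamSq ⇑f ≤ ENNReal.ofReal (Real.exp (-r ^ 2))) := by
  exact ⟨tendsto_root_eLpNorm_gaussConv f hp, fun r hr =>
    (FT_eq_zero_on_ball_iff f hr).trans (expNegLamSq_le_iff f hr).symm⟩
end
end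

section
/- Let γ > 0, let f be a Schwartz function on ℝ, and let P(t) = ∑_{j=0}^N c_j t^j be a non-constant polynomial with real coefficients. Let A = ∑_{j=0}^N c_j (−i)^j T_γ^j, so that ℱ_γ(Af) = P·ℱ_γ f. Then for every p ∈ [1,∞], lim_{n→∞} ‖Aⁿ f‖_{L^p(μ_γ)}^{1/n} = sup{ |P(λ)| : λ ∈ supp ℱ_γ f }, as an equality in [0,∞]. -/
open MeasureTheory Filter SchwartzMap
open scoped ENNReal

noncomputable section

/-- The one-dimensional Dunkl operator
`T_γ f(x) = f'(x) + γ (f(x) - f(-x))/x` for `x ≠ 0`, `T_γ f(0) = (1+2γ) f'(0)`. -/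
def Tdunkl (γ : ℝ) (f : ℝ → ℂ) : ℝ → ℂ := fun x =>
  if x = 0 then (1 + 2 * Complex.ofReal γ) * deriv f 0
  else deriv f x + Complex.ofReal γ * (f x - f (-x)) / Complex.ofReal x

/-- The normalized Bessel function
`j_α(z) = Γ(α+1) ∑ (-1)^n (z/2)^{2n} / (n! Γ(α+n+1))`. -/
def jBessel (α : ℝ) (z : ℂ) : ℂ :=
  Complex.ofReal (Real.Gamma (α + 1)) *
    ∑' n : ℕ, (-1) ^ n * (z / 2) ^ (2 * n) /
      ((n.factorial : ℂ) * Complex.ofReal (Real.Gamma (α + n + 1)))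

/-- The one-dimensional Dunkl kernel
`E_γ(λ, x) = j_{γ-1/2}(λx) - (iλx/(2γ+1)) j_{γ+1/2}(λx)`. -/
def Ekern (γ lam x : ℝ) : ℂ :=
  jBessel (γ - 1 / 2) (Complex.ofReal (lam * x)) -
    Complex.I * Complex.ofReal (lam * x) / (2 * Complex.ofReal γ + 1) *
      jBessel (γ + 1 / 2) (Complex.ofReal (lam * x))

/-- The one-dimensional Dunkl transform `ℱ_γ f(λ) = ∫ f(x) E_γ(λ,x) |x|^{2γ} dx`. -/
def FDunkl (γ : ℝ) (f : ℝ → ℂ) (lam : ℝ) : ℂ :=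
  ∫ x : ℝ, f x * Ekern γ lam x * Complex.ofReal (|x| ^ (2 * γ))

/-- The operator `A = ∑_{j=0}^N c_j (-i)^j T_γ^j`. -/
def Aop (γ : ℝ) (N : ℕ) (c : ℕ → ℝ) (f : ℝ → ℂ) : ℝ → ℂ := fun x =>
  ∑ j ∈ Finset.range (N + 1),
    Complex.ofReal (c j) * (-Complex.I) ^ j * (Tdunkl γ)^[j] f x

/-- Radial averages `x ↦ ∫₀¹ tᵏ g(tx) dt`. -/
def radialMean (k : ℕ) (g : ℝ → ℂ) (x : ℝ) : ℂ := ∫ t in (0 : ℝ)..1, ((t ^ k : ℝ) : ℂ) * g (t * x)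

lemma hasDerivAt_radialMean (k : ℕ) (g : 𝓢(ℝ, ℂ)) (x : ℝ) :
    HasDerivAt (radialMean k g) (radialMean (k + 1) (derivCLM ℂ ℂ g) x) x := by
  obtain ⟨C, _, hC⟩ := (derivCLM ℂ ℂ g).decay 0 0
  simp only [pow_zero, one_mul, norm_iteratedFDeriv_zero] at hC
  refine (intervalIntegral.hasDerivAt_integral_of_dominated_loc_of_deriv_le
    (F := fun x t => ((t ^ k : ℝ) : ℂ) * g (t * x))
    (F' := fun x t => ((t ^ (k + 1) : ℝ) : ℂ) * derivCLM ℂ ℂ g (t * x))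
    (bound := fun _ => C) (s := Set.univ) Filter.univ_mem ?_ ?_ ?_ ?_ ?_ ?_).2
  · exact Eventually.of_forall fun y => (by fun_prop : Continuous _).aestronglyMeasurable
  · exact (by fun_prop : Continuous _).intervalIntegrable _ _
  · exact (by fun_prop : Continuous _).aestronglyMeasurable
  · refine Eventually.of_forall fun t ht y _ => ?_
    rw [Set.uIoc_of_le zero_le_one] at ht
    rw [norm_mul, Complex.norm_real, Real.norm_of_nonneg (by have := ht.1.le; positivity)]
    calc t ^ (k + 1) * ‖derivCLM ℂ ℂ g (t * y)‖ ≤ 1 * C := by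
          gcongr
          · exact pow_le_one₀ ht.1.le ht.2
          · exact hC _
      _ = C := one_mul C
  · exact intervalIntegrable_const
  · refine Eventually.of_forall fun t _ y _ => ?_
    have h1 : HasDerivAt g (derivCLM ℂ ℂ g (t * y)) (t * y) := by
      rw [derivCLM_apply]; exact g.differentiableAt.hasDerivAt
    have h2 := (h1.scomp y ((hasDerivAt_id y).const_mul t)).const_mul ((t ^ k : ℝ) : ℂ)
    refine HasDerivAt.congr_deriv h2 ?_
    simp only [mul_one, Complex.real_smul]
    push_cast; ring

lemma iteratedDeriv_radialMean (n : ℕ) : ∀ (k : ℕ) (g : 𝓢(ℝ, ℂ)),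
    iteratedDeriv n (radialMean k g) = radialMean (k + n) ((derivCLM ℂ ℂ)^[n] g) := by
  induction n with
  | zero => intro k g; simp
  | succ n ih =>
    intro k g
    rw [iteratedDeriv_succ', funext fun x => (hasDerivAt_radialMean k g x).deriv, ih,
      Function.iterate_succ_apply]
    congr 1; ring

lemma contDiff_radialMean (k : ℕ) (g : 𝓢(ℝ, ℂ)) : ContDiff ℝ (⊤ : ℕ∞) (radialMean k g) := by
  refine contDiff_of_differentiable_iteratedDeriv fun m _ => ?_
  rw [iteratedDeriv_radialMean]
  exact fun x => (hasDerivAt_radialMean _ _ x).differentiableAt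

lemma norm_radialMean_le (k : ℕ) (g : 𝓢(ℝ, ℂ)) : ∃ C, ∀ x, ‖radialMean k g x‖ ≤ C := by
  obtain ⟨C, _, hC⟩ := g.decay 0 0
  simp only [pow_zero, one_mul, norm_iteratedFDeriv_zero] at hC
  refine ⟨C, fun x => ?_⟩
  have := intervalIntegral.norm_integral_le_of_norm_le_const (a := 0) (b := 1) (C := C)
    (f := fun t => ((t ^ k : ℝ) : ℂ) * g (t * x)) ?_
  · simpa [radialMean] using this
  · intro t ht
    rw [Set.uIoc_of_le zero_le_one] at ht
    rw [norm_mul, Complex.norm_real, Real.norm_of_nonneg (by have := ht.1.le; positivity)]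
    calc t ^ k * ‖g (t * x)‖ ≤ 1 * C := by
          gcongr
          · exact pow_le_one₀ ht.1.le ht.2
          · exact hC _
      _ = C := one_mul C

lemma mul_radialMean_deriv (g : 𝓢(ℝ, ℂ)) (h0 : g 0 = 0) (x : ℝ) :
    (x : ℂ) * radialMean 0 (derivCLM ℂ ℂ g) x = g x := by
  have h := intervalIntegral.integral_eq_sub_of_hasDerivAt (a := 0) (b := 1)
    (f := fun t => g (t * x)) (f' := fun t => (x : ℂ) * derivCLM ℂ ℂ g (t * x)) ?_ ?_
  · simpa [radialMean, h0] using h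
  · intro t _
    have h1 : HasDerivAt g (derivCLM ℂ ℂ g (t * x)) (t * x) := by
      rw [derivCLM_apply]; exact g.differentiableAt.hasDerivAt
    have h2 := h1.scomp t ((hasDerivAt_id t).mul_const x)
    exact HasDerivAt.congr_deriv h2 (by simp)
  · exact (by fun_prop : Continuous _).intervalIntegrable _ _

lemma iteratedDeriv_ofReal_mul (h : ℝ → ℂ) (hh : ContDiff ℝ (⊤ : ℕ∞) h) (n : ℕ) (x : ℝ) :
    iteratedDeriv n (fun x : ℝ => (x : ℂ) * h x) x =
      x * iteratedDeriv n h x + n * iteratedDeriv (n - 1) h x := by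
  induction n generalizing x with
  | zero => simp
  | succ n ih =>
    rw [iteratedDeriv_succ, funext ih]
    have hd : ∀ m y, HasDerivAt (iteratedDeriv m h) (iteratedDeriv (m + 1) h y) y := fun m y => by
      rw [iteratedDeriv_succ]
      exact ((hh.differentiable_iteratedDeriv m
        (by exact_mod_cast WithTop.coe_lt_top m)) y).hasDerivAt
    have hx : HasDerivAt (fun x : ℝ => (x : ℂ)) 1 x := Complex.ofRealCLM.hasDerivAt
    rcases n with _ | n
    · have := (hx.mul (hd 0 x)).deriv
      simp only [Pi.mul_def] at this
      simp [iteratedDeriv_zero, iteratedDeriv_one] at this ⊢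
      rw [this]; ring
    · have := ((hx.mul (hd (n + 1) x)).add ((hd n x).const_mul ((n + 1 : ℕ) : ℂ))).deriv
      simp only [Pi.mul_def, Pi.add_def] at this
      simp only [Nat.add_sub_cancel]
      rw [this]; push_cast; ring

lemma SchwartzMap.exists_ofReal_mul_eq (g : 𝓢(ℝ, ℂ)) (h0 : g 0 = 0) :
    ∃ h : 𝓢(ℝ, ℂ), ∀ x : ℝ, (x : ℂ) * h x = g x := by
  set h := radialMean 0 (derivCLM ℂ ℂ g) with hdef
  have hs : ContDiff ℝ (⊤ : ℕ∞) h := contDiff_radialMean _ _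
  have key : ∀ k n : ℕ, ∃ C : ℝ, ∀ x, ‖x‖ ^ k * ‖iteratedDeriv n h x‖ ≤ C := by
    intro k
    induction k with
    | zero =>
      intro n
      rw [hdef, iteratedDeriv_radialMean]
      simpa using norm_radialMean_le (0 + n) ((derivCLM ℂ ℂ)^[n] (derivCLM ℂ ℂ g))
    | succ k ih =>
      intro n
      obtain ⟨C, hC⟩ := ih (n - 1)
      obtain ⟨D, _, hD⟩ := g.decay k n
      refine ⟨D + n * C, fun x => ?_⟩
      have e := iteratedDeriv_ofReal_mul h hs n x
      rw [show (fun x : ℝ => (x : ℂ) * h x) = g from funext (mul_radialMean_deriv g h0)] at e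
      have e2 : (x : ℂ) * iteratedDeriv n h x
          = iteratedDeriv n g x - n * iteratedDeriv (n - 1) h x := by rw [e]; ring
      have hD' := hD x
      rw [norm_iteratedFDeriv_eq_norm_iteratedDeriv] at hD'
      calc ‖x‖ ^ (k + 1) * ‖iteratedDeriv n h x‖
          = ‖x‖ ^ k * ‖(x : ℂ) * iteratedDeriv n h x‖ := by
            rw [norm_mul, Complex.norm_real]; ring
        _ ≤ ‖x‖ ^ k * (‖iteratedDeriv n g x‖ + ‖(n : ℂ) * iteratedDeriv (n - 1) h x‖) := by
            rw [e2]; gcongr; exact norm_sub_le _ _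
        _ = ‖x‖ ^ k * ‖iteratedDeriv n g x‖ + n * (‖x‖ ^ k * ‖iteratedDeriv (n - 1) h x‖) := by
            rw [norm_mul, Complex.norm_natCast]; ring
        _ ≤ D + n * C := by gcongr; exact hC x
  refine ⟨⟨h, hs, fun k n => ?_⟩, mul_radialMean_deriv g h0⟩
  simpa only [norm_iteratedFDeriv_eq_norm_iteratedDeriv] using key k n

lemma summable_of_abs_le_inv_factorial {a : ℕ → ℝ} (ha : ∀ n, |a n| ≤ 1 / n.factorial) (y : ℝ) :
    Summable fun n => a n * y ^ n := by
  refine Summable.of_norm_bounded (Real.summable_pow_div_factorial |y|) fun n => ?_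
  rw [norm_mul, norm_pow, Real.norm_eq_abs, Real.norm_eq_abs, div_eq_mul_one_div, mul_comm]
  gcongr
  exact ha n

lemma hasDerivAt_tsum_of_abs_le_inv_factorial {a : ℕ → ℝ}
    (ha : ∀ n, |a n| ≤ 1 / n.factorial) (y : ℝ) :
    HasDerivAt (fun y => ∑' n, a n * y ^ n) (∑' n : ℕ, (n + 1) * a (n + 1) * y ^ n) y := by
  have hb : ∀ (n : ℕ) (t : ℝ), |(n + 1) * a (n + 1) * t ^ n| ≤ |t| ^ n / n.factorial := by
    intro n t
    rw [abs_mul, abs_mul, abs_pow, abs_of_nonneg (by positivity : (0 : ℝ) ≤ n + 1)]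
    have h1 := ha (n + 1)
    rw [Nat.factorial_succ] at h1
    have : (n + 1 : ℝ) * |a (n + 1)| ≤ 1 / n.factorial := by
      calc (n + 1 : ℝ) * |a (n + 1)| ≤ (n + 1) * (1 / ((n + 1) * n.factorial : ℕ)) := by gcongr
        _ = 1 / n.factorial := by push_cast; field_simp
    calc (n + 1 : ℝ) * |a (n + 1)| * |t| ^ n ≤ 1 / n.factorial * |t| ^ n := by gcongr
      _ = _ := by ring
  set R := |y| + 1
  have hu : Summable fun n : ℕ => (fun n => if n = 0 then 0 else
      R ^ (n - 1) / (n - 1).factorial : ℕ → ℝ) n := by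
    rw [← summable_nat_add_iff 1]
    simpa using Real.summable_pow_div_factorial R
  have hbound : ∀ (n : ℕ) (t : ℝ), t ∈ Metric.ball (0 : ℝ) R →
      ‖a n * (n * t ^ (n - 1))‖ ≤ if n = 0 then 0 else R ^ (n - 1) / (n - 1).factorial := by
    intro n t ht
    rcases n with _ | n
    · simp
    · have ht' : |t| ≤ R := by simpa using (mem_ball_zero_iff.1 ht).le
      have := hb n t
      simp only [Nat.add_sub_cancel, Nat.succ_ne_zero, if_false, Real.norm_eq_abs]
      calc |a (n + 1) * ((n + 1 : ℕ) * t ^ n)| = |(n + 1) * a (n + 1) * t ^ n| := by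
            push_cast; congr 1; ring
        _ ≤ |t| ^ n / n.factorial := this
        _ ≤ _ := by gcongr
  have hy : y ∈ Metric.ball (0 : ℝ) R := by simp [R]
  have h := hasDerivAt_tsum_of_isPreconnected hu Metric.isOpen_ball
    (convex_ball (0 : ℝ) R).isPreconnected
    (fun n t _ => (hasDerivAt_pow n t).const_mul (a n)) hbound
    hy (summable_of_abs_le_inv_factorial ha y) hy
  refine HasDerivAt.congr_deriv h ?_
  rw [(Summable.of_norm_bounded hu fun n => hbound n y hy).tsum_eq_zero_add]
  simp only [Nat.cast_zero, zero_mul, mul_zero, zero_add, Nat.add_sub_cancel]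
  refine tsum_congr fun n => ?_
  push_cast; ring

/-- Taylor coefficients, in the variable `z ^ 2`, of the normalized Bessel function. -/
def besselCoeff (α : ℝ) (n : ℕ) : ℝ :=
  Real.Gamma (α + 1) * (-1) ^ n / (4 ^ n * n.factorial * Real.Gamma (α + n + 1))

/-- The entire function `S` with `j_α(z) = S(z ^ 2)`. -/
def besselSeries (α y : ℝ) : ℝ := ∑' n, besselCoeff α n * y ^ n

lemma Real.Gamma_le_four_pow_mul {α : ℝ} (hα : -1 / 2 < α) (n : ℕ) :
    Real.Gamma (α + 1) ≤ 4 ^ n * Real.Gamma (α + n + 1) := by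
  induction n with
  | zero => simp
  | succ n ih =>
    have hpos : 0 < α + n + 1 := by have : (0 : ℝ) ≤ n := n.cast_nonneg; linarith
    have h1 : Real.Gamma (α + (n + 1 : ℕ) + 1) = (α + n + 1) * Real.Gamma (α + n + 1) := by
      rw [← Real.Gamma_add_one hpos.ne']; congr 1; push_cast; ring
    rw [h1]
    have h2 := Real.Gamma_pos_of_pos hpos
    have h3 : 1 ≤ 4 * (α + n + 1) := by have : (0 : ℝ) ≤ n := n.cast_nonneg; linarith
    calc Real.Gamma (α + 1) ≤ 4 ^ n * Real.Gamma (α + n + 1) * 1 := by rwa [mul_one]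
      _ ≤ 4 ^ n * Real.Gamma (α + n + 1) * (4 * (α + n + 1)) := by gcongr
      _ = _ := by ring

lemma abs_besselCoeff_le {α : ℝ} (hα : -1 / 2 < α) (n : ℕ) :
    |besselCoeff α n| ≤ 1 / n.factorial := by
  have h1 : 0 < Real.Gamma (α + 1) := Real.Gamma_pos_of_pos (by linarith)
  have h2 : 0 < Real.Gamma (α + n + 1) :=
    Real.Gamma_pos_of_pos (by have : (0 : ℝ) ≤ n := n.cast_nonneg; linarith)
  have h3 : (0 : ℝ) < n.factorial := by positivity
  rw [besselCoeff, abs_div, abs_mul, abs_pow, abs_neg, abs_one, one_pow, mul_one, abs_of_pos h1,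
    abs_of_pos (by positivity), div_le_div_iff₀ (by positivity) h3, one_mul]
  calc _ ≤ (4 ^ n * Real.Gamma (α + n + 1)) * n.factorial := by
        gcongr; exact Real.Gamma_le_four_pow_mul hα n
    _ = _ := by ring

lemma jBessel_ofReal (α z : ℝ) : jBessel α (z : ℂ) = (besselSeries α (z ^ 2) : ℝ) := by
  rw [jBessel, besselSeries, Complex.ofReal_tsum, ← tsum_mul_left]
  refine tsum_congr fun n => ?_
  rw [besselCoeff]
  push_cast
  rw [div_pow, pow_mul (2 : ℂ), show (2 : ℂ) ^ 2 = 4 by norm_num, ← pow_mul, div_eq_mul_inv,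
    div_eq_mul_inv, div_eq_mul_inv, mul_inv, mul_inv, mul_inv]
  ring

lemma besselSeries_zero {α : ℝ} (hα : -1 / 2 < α) : besselSeries α 0 = 1 := by
  rw [besselSeries, tsum_eq_single 0]
  · have h1 : 0 < Real.Gamma (α + 1) := Real.Gamma_pos_of_pos (by linarith)
    simp [besselCoeff, h1.ne']
  · intro n hn; simp [hn]

lemma hasDerivAt_besselSeries {α : ℝ} (hα : -1 / 2 < α) (y : ℝ) :
    HasDerivAt (besselSeries α) (-(besselSeries (α + 1) y) / (4 * (α + 1))) y := by
  have h := hasDerivAt_tsum_of_abs_le_inv_factorial (abs_besselCoeff_le hα) y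
  refine HasDerivAt.congr_deriv h ?_
  symm
  rw [besselSeries, neg_div, div_eq_mul_inv, ← tsum_mul_right, ← tsum_neg]
  refine tsum_congr fun n => ?_
  have h1 : 0 < Real.Gamma (α + 1) := Real.Gamma_pos_of_pos (by linarith)
  have h2 : 0 < Real.Gamma (α + n + 1 + 1) :=
    Real.Gamma_pos_of_pos (by have : (0 : ℝ) ≤ n := n.cast_nonneg; linarith)
  have h3 : α + 1 ≠ 0 := by linarith
  rw [besselCoeff, besselCoeff, Real.Gamma_add_one h3, Nat.factorial_succ]
  rw [show α + 1 + (n : ℝ) + 1 = α + n + 1 + 1 by ring,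
    show α + ((n + 1 : ℕ) : ℝ) + 1 = α + n + 1 + 1 by push_cast; ring]
  push_cast
  field_simp
  ring

lemma besselSeries_add_mul {α : ℝ} (hα : -1 / 2 < α) (y : ℝ) :
    besselSeries (α + 1) y + y / (α + 1) * (-(besselSeries (α + 1 + 1) y) / (4 * (α + 1 + 1))) =
      besselSeries α y := by
  have hα' : -1 / 2 < α + 1 := by linarith
  have h := (hasDerivAt_besselSeries hα' y).unique
    (hasDerivAt_tsum_of_abs_le_inv_factorial (abs_besselCoeff_le hα') y)
  have hs := summable_of_abs_le_inv_factorial (abs_besselCoeff_le hα') y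
  have hs0 := summable_of_abs_le_inv_factorial (abs_besselCoeff_le hα) y
  have h3 : α + 1 ≠ 0 := by linarith
  have hc : ∀ n : ℕ, besselCoeff α n * y ^ n - besselCoeff (α + 1) n * y ^ n =
      n / (α + 1) * besselCoeff (α + 1) n * y ^ n := by
    intro n
    have h2 : 0 < α + n + 1 := by have : (0 : ℝ) ≤ n := n.cast_nonneg; linarith
    have h4 := Real.Gamma_pos_of_pos h2
    rw [besselCoeff, besselCoeff, Real.Gamma_add_one h3,
      show α + 1 + (n : ℝ) + 1 = α + n + 1 + 1 by ring, Real.Gamma_add_one h2.ne']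
    field_simp
    ring
  rw [h, ← eq_sub_iff_add_eq', besselSeries, besselSeries, ← hs0.tsum_sub hs,
    (hs0.sub hs).tsum_eq_zero_add, ← tsum_mul_left]
  simp only [hc]
  simp only [Nat.cast_zero, zero_div, zero_mul, zero_add]
  refine tsum_congr fun n => ?_
  push_cast
  field_simp
  ring

/-- Even part of the Dunkl kernel. -/
def dunklEven (γ z : ℝ) : ℝ := besselSeries (γ - 1 / 2) (z ^ 2)

lemma dunklEven_neg (γ z : ℝ) : dunklEven γ (-z) = dunklEven γ z := by simp [dunklEven]

lemma dunklEven_zero {γ : ℝ} (hγ : 0 < γ) : dunklEven γ 0 = 1 := by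
  simp [dunklEven, besselSeries_zero (show -1 / 2 < γ - 2⁻¹ by linarith)]

lemma hasDerivAt_dunklEven {γ : ℝ} (hγ : 0 < γ) (z : ℝ) :
    HasDerivAt (dunklEven γ) (-(z / (2 * γ + 1) * dunklEven (γ + 1) z)) z := by
  have h := (hasDerivAt_besselSeries (show -1 / 2 < γ - 1 / 2 by linarith) (z ^ 2)).comp z
    (hasDerivAt_pow 2 z)
  refine HasDerivAt.congr_deriv h ?_
  rw [dunklEven, show γ - 1 / 2 + 1 = γ + 1 - 1 / 2 by ring,
    show 4 * (γ + 1 - 1 / 2) = 2 * (2 * γ + 1) by ring]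
  have : 2 * γ + 1 ≠ 0 := by linarith
  field_simp
  norm_num
  ring

/-- Odd part of the Dunkl kernel. -/
def dunklOdd (γ z : ℝ) : ℝ := z / (2 * γ + 1) * dunklEven (γ + 1) z

lemma dunklOdd_neg (γ z : ℝ) : dunklOdd γ (-z) = -dunklOdd γ z := by
  rw [dunklOdd, dunklOdd, dunklEven_neg]; ring

lemma hasDerivAt_dunklOdd {γ : ℝ} (hγ : 0 < γ) (z : ℝ) :
    HasDerivAt (dunklOdd γ)
      (dunklEven γ z - 2 * γ / (2 * γ + 1) * dunklEven (γ + 1) z) z := by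
  have h := ((hasDerivAt_id z).div_const (2 * γ + 1)).mul
    (hasDerivAt_dunklEven (γ := γ + 1) (by linarith) z)
  refine HasDerivAt.congr_deriv h ?_
  have h2 := besselSeries_add_mul (show -1 / 2 < γ - 1 / 2 by linarith) (z ^ 2)
  rw [show γ - 1 / 2 + 1 + 1 = γ + 1 + 1 - 1 / 2 by ring,
    show γ - 1 / 2 + 1 = γ + 1 - 1 / 2 by ring] at h2
  change dunklEven (γ + 1) z + _ * (-dunklEven (γ + 1 + 1) z / _) = dunklEven γ z at h2
  rw [← h2]
  have h3 : 2 * γ + 1 ≠ 0 := by linarith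
  have h4 : γ + 1 - 1 / 2 ≠ 0 := by linarith
  have h5 : γ + 1 + 1 - 1 / 2 ≠ 0 := by linarith
  have h6 : 2 * (γ + 1) + 1 ≠ 0 := by linarith
  rw [show γ + 1 + 1 - 1 / 2 = (2 * (γ + 1) + 1) / 2 by ring,
    show γ + 1 - 1 / 2 = (2 * γ + 1) / 2 by ring]
  simp only [id]
  field_simp
  ring

lemma dunkl_sq_add_sq_le {γ : ℝ} (hγ : 0 < γ) (z : ℝ) :
    dunklEven γ z ^ 2 + dunklOdd γ z ^ 2 ≤ 1 := by
  have hd : ∀ z, HasDerivAt (fun z => dunklEven γ z ^ 2 + dunklOdd γ z ^ 2)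
      (-(4 * γ / (2 * γ + 1) ^ 2 * z * dunklEven (γ + 1) z ^ 2)) z := by
    intro z
    refine HasDerivAt.congr_deriv
      (((hasDerivAt_dunklEven hγ z).pow 2).add ((hasDerivAt_dunklOdd hγ z).pow 2)) ?_
    rw [dunklOdd]
    have h3 : 2 * γ + 1 ≠ 0 := by linarith
    norm_num
    field_simp
    ring
  have hanti : AntitoneOn (fun z => dunklEven γ z ^ 2 + dunklOdd γ z ^ 2) (Set.Ici 0) := by
    refine antitoneOn_of_deriv_nonpos (convex_Ici 0)
      (fun z _ => (hd z).continuousAt.continuousWithinAt)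
      (fun z _ => (hd z).differentiableAt.differentiableWithinAt) fun z hz => ?_
    rw [interior_Ici] at hz
    have : 0 < z := hz
    rw [(hd z).deriv, neg_nonpos]
    positivity
  have h0 : ∀ z, 0 ≤ z → dunklEven γ z ^ 2 + dunklOdd γ z ^ 2 ≤ 1 := by
    intro z hz
    have := hanti (Set.self_mem_Ici) hz hz
    simpa [dunklEven_zero hγ, dunklOdd] using this
  rcases le_total 0 z with hz | hz
  · exact h0 z hz
  · have := h0 (-z) (by linarith)
    rwa [dunklEven_neg, dunklOdd_neg, neg_sq] at this

lemma abs_dunklEven_le {γ : ℝ} (hγ : 0 < γ) (z : ℝ) : |dunklEven γ z| ≤ 1 := by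
  have := dunkl_sq_add_sq_le hγ z
  exact abs_le_one_iff_mul_self_le_one.2 (by nlinarith [sq_nonneg (dunklOdd γ z)])

lemma abs_dunklOdd_le {γ : ℝ} (hγ : 0 < γ) (z : ℝ) : |dunklOdd γ z| ≤ 1 := by
  have := dunkl_sq_add_sq_le hγ z
  exact abs_le_one_iff_mul_self_le_one.2 (by nlinarith [sq_nonneg (dunklEven γ z)])

/-- The Dunkl kernel as a function of the product of its arguments. -/
def dunklExp (γ z : ℝ) : ℂ := dunklEven γ z - Complex.I * dunklOdd γ z

lemma Ekern_eq (γ lam x : ℝ) : Ekern γ lam x = dunklExp γ (lam * x) := by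
  rw [Ekern, jBessel_ofReal, jBessel_ofReal, dunklExp, dunklOdd, dunklEven, dunklEven,
    show γ + 1 - 1 / 2 = γ + 1 / 2 by ring]
  push_cast
  ring

lemma dunklExp_zero {γ : ℝ} (hγ : 0 < γ) : dunklExp γ 0 = 1 := by
  simp [dunklExp, dunklEven_zero hγ, dunklOdd]

lemma norm_dunklExp_le {γ : ℝ} (hγ : 0 < γ) (z : ℝ) : ‖dunklExp γ z‖ ≤ 1 := by
  have h := dunkl_sq_add_sq_le hγ z
  rw [← sq_le_one_iff₀ (norm_nonneg _), ← Complex.normSq_eq_norm_sq, Complex.normSq_apply]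
  simp [dunklExp]
  nlinarith

/-- Derivative of `dunklExp`. -/
def dunklExpDeriv (γ z : ℝ) : ℂ :=
  -(dunklOdd γ z : ℂ) - Complex.I *
    ((dunklEven γ z - 2 * γ / (2 * γ + 1) * dunklEven (γ + 1) z : ℝ) : ℂ)

lemma hasDerivAt_dunklExp {γ : ℝ} (hγ : 0 < γ) (z : ℝ) :
    HasDerivAt (dunklExp γ) (dunklExpDeriv γ z) z := by
  have h1 := (hasDerivAt_dunklEven hγ z).ofReal_comp
  have h2 := (hasDerivAt_dunklOdd hγ z).ofReal_comp
  refine HasDerivAt.congr_deriv (h1.sub (h2.const_mul Complex.I)) ?_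
  rw [dunklExpDeriv, dunklOdd]; push_cast; ring

lemma norm_dunklExpDeriv_le {γ : ℝ} (hγ : 0 < γ) (z : ℝ) : ‖dunklExpDeriv γ z‖ ≤ 3 := by
  have h1 := abs_dunklOdd_le hγ z
  have h2 := abs_dunklEven_le hγ z
  have h3 := abs_dunklEven_le (show 0 < γ + 1 by linarith) z
  have h4 : |2 * γ / (2 * γ + 1)| ≤ 1 := by
    rw [abs_of_pos (by positivity), div_le_one (by positivity)]; linarith
  calc ‖dunklExpDeriv γ z‖ ≤ |dunklOdd γ z| +
        |dunklEven γ z - 2 * γ / (2 * γ + 1) * dunklEven (γ + 1) z| := by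
        refine (norm_sub_le _ _).trans ?_
        rw [norm_neg, norm_mul, Complex.norm_I, one_mul, Complex.norm_real, Complex.norm_real]
        rfl
    _ ≤ 1 + (1 + 1 * 1) := by
        gcongr
        refine (abs_sub _ _).trans ?_
        rw [abs_mul]
        gcongr
    _ = 3 := by norm_num

lemma continuous_dunklExp {γ : ℝ} (hγ : 0 < γ) : Continuous (dunklExp γ) :=
  continuous_iff_continuousAt.2 fun z => (hasDerivAt_dunklExp hγ z).continuousAt

lemma continuous_dunklEven {γ : ℝ} (hγ : 0 < γ) : Continuous (dunklEven γ) :=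
  continuous_iff_continuousAt.2 fun z => (hasDerivAt_dunklEven hγ z).continuousAt

lemma continuous_dunklExpDeriv {γ : ℝ} (hγ : 0 < γ) : Continuous (dunklExpDeriv γ) := by
  have h1 := continuous_dunklEven hγ
  have h2 := continuous_dunklEven (show 0 < γ + 1 by linarith)
  unfold dunklExpDeriv dunklOdd
  fun_prop

lemma dunklExpDeriv_add {γ : ℝ} (hγ : 0 < γ) {z : ℝ} (hz : z ≠ 0) :
    dunklExpDeriv γ z + γ * (dunklExp γ z - dunklExp γ (-z)) / z = -Complex.I * dunklExp γ z := by
  have h3 : (2 * (γ : ℂ) + 1) ≠ 0 := by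
    exact_mod_cast (by positivity : 2 * γ + 1 ≠ 0)
  have hz' : (z : ℂ) ≠ 0 := by exact_mod_cast hz
  rw [dunklExpDeriv, dunklExp, dunklExp, dunklOdd_neg, dunklEven_neg, dunklOdd]
  push_cast
  field_simp
  linear_combination (-(z : ℂ) ^ 2 * dunklEven (γ + 1) z) * Complex.I_sq

lemma dunklExpDeriv_zero {γ : ℝ} (hγ : 0 < γ) :
    (1 + 2 * γ) * dunklExpDeriv γ 0 = -Complex.I := by
  have h3 : (2 * (γ : ℂ) + 1) ≠ 0 := by
    exact_mod_cast (by positivity : 2 * γ + 1 ≠ 0)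
  rw [dunklExpDeriv, dunklEven_zero hγ, dunklEven_zero (by linarith : 0 < γ + 1)]
  simp [dunklOdd]
  field_simp
  ring

/-- An integer exponent making `(1 + |x| ^ m)⁻¹` integrable against `|x| ^ (2 * γ)`. -/
def dunklExponent (γ : ℝ) : ℕ := ⌈2 * γ⌉₊ + 2

lemma rpow_abs_le {γ : ℝ} (hγ : 0 < γ) (x : ℝ) :
    |x| ^ (2 * γ) ≤ 2 * (1 + |x| ^ dunklExponent γ) * (1 + x ^ 2)⁻¹ := by
  rw [← div_eq_mul_inv, le_div_iff₀ (by positivity)]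
  have hx := abs_nonneg x
  rw [← sq_abs x]
  rcases le_total |x| 1 with h | h
  · have h1 : |x| ^ (2 * γ) ≤ 1 := Real.rpow_le_one hx h (by positivity)
    have h2 : |x| ^ 2 ≤ 1 := pow_le_one₀ hx h
    calc |x| ^ (2 * γ) * (1 + |x| ^ 2) ≤ 1 * (1 + 1) := by gcongr
      _ = 2 * (1 + 0) := by norm_num
      _ ≤ _ := by gcongr; positivity
  · have h1 : |x| ^ (2 * γ) ≤ |x| ^ ⌈2 * γ⌉₊ := by
      rw [← Real.rpow_natCast]
      exact Real.rpow_le_rpow_of_exponent_le h (Nat.le_ceil _)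
    have h2 : 1 ≤ |x| ^ 2 := one_le_pow₀ h
    calc |x| ^ (2 * γ) * (1 + |x| ^ 2) ≤ |x| ^ ⌈2 * γ⌉₊ * (|x| ^ 2 + |x| ^ 2) := by gcongr
      _ = 2 * (0 + |x| ^ dunklExponent γ) := by rw [dunklExponent, pow_add]; ring
      _ ≤ _ := by gcongr; positivity

/-- Decay sufficient for integrability against `|x| ^ (2 * γ)`. -/
def DunklDecay (γ : ℝ) (f : ℝ → ℂ) : Prop :=
  ∃ C, ∀ x, ‖f x‖ * (1 + |x| ^ dunklExponent γ) ≤ C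

lemma DunklDecay.norm_mul_weight_le {γ : ℝ} (hγ : 0 < γ) {f : ℝ → ℂ} (hf : DunklDecay γ f) :
    ∃ C, ∀ x, ‖f x‖ * |x| ^ (2 * γ) ≤ C * (1 + x ^ 2)⁻¹ := by
  obtain ⟨C, hC⟩ := hf
  refine ⟨2 * C, fun x => ?_⟩
  calc ‖f x‖ * |x| ^ (2 * γ)
      ≤ ‖f x‖ * (2 * (1 + |x| ^ dunklExponent γ) * (1 + x ^ 2)⁻¹) := by
        gcongr; exact rpow_abs_le hγ x
    _ = 2 * (‖f x‖ * (1 + |x| ^ dunklExponent γ)) * (1 + x ^ 2)⁻¹ := by ring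
    _ ≤ _ := by gcongr; exact hC x

lemma DunklDecay.bounded {γ : ℝ} {f : ℝ → ℂ} (hf : DunklDecay γ f) : ∃ C, ∀ x, ‖f x‖ ≤ C := by
  obtain ⟨C, hC⟩ := hf
  refine ⟨C, fun x => le_trans ?_ (hC x)⟩
  have : 0 ≤ |x| ^ dunklExponent γ := by positivity
  nlinarith [norm_nonneg (f x)]

lemma continuous_dunklWeight {γ : ℝ} (hγ : 0 < γ) :
    Continuous fun x : ℝ => ((|x| ^ (2 * γ) : ℝ) : ℂ) :=
  Complex.continuous_ofReal.comp (continuous_abs.rpow_const fun _ => Or.inr (by positivity))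

lemma DunklDecay.integrable_mul {γ : ℝ} (hγ : 0 < γ) {f g : ℝ → ℂ} (hf : DunklDecay γ f)
    (hfm : Measurable f) (hgm : Measurable g) {D : ℝ} (hg : ∀ x, ‖g x‖ ≤ D) :
    Integrable fun x : ℝ => f x * g x * ((|x| ^ (2 * γ) : ℝ) : ℂ) := by
  obtain ⟨C, hC⟩ := hf.norm_mul_weight_le hγ
  refine ((integrable_inv_one_add_sq.const_mul C).const_mul D).mono'
    ((hfm.mul hgm).mul (continuous_dunklWeight hγ).measurable).aestronglyMeasurable
    (Eventually.of_forall fun x => ?_)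
  have hw : 0 ≤ |x| ^ (2 * γ) := by positivity
  have hD : 0 ≤ D := (norm_nonneg _).trans (hg x)
  rw [norm_mul, norm_mul, Complex.norm_real, Real.norm_of_nonneg hw]
  calc ‖f x‖ * ‖g x‖ * |x| ^ (2 * γ) = ‖g x‖ * (‖f x‖ * |x| ^ (2 * γ)) := by ring
    _ ≤ D * (C * (1 + x ^ 2)⁻¹) := mul_le_mul (hg x) (hC x) (by positivity) hD

lemma DunklDecay.integrable {γ : ℝ} (hγ : 0 < γ) {f : ℝ → ℂ} (hf : DunklDecay γ f)
    (hfm : Measurable f) : Integrable fun x : ℝ => f x * ((|x| ^ (2 * γ) : ℝ) : ℂ) := by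
  simpa using hf.integrable_mul hγ hfm (measurable_const (a := (1 : ℂ))) (D := 1) (by simp)

lemma SchwartzMap.dunklDecay (γ : ℝ) (f : 𝓢(ℝ, ℂ)) : DunklDecay γ f := by
  obtain ⟨C, _, hC⟩ := f.decay 0 0
  obtain ⟨D, _, hD⟩ := f.decay (dunklExponent γ) 0
  refine ⟨C + D, fun x => ?_⟩
  have h1 := hC x
  have h2 := hD x
  simp only [norm_iteratedFDeriv_zero, Real.norm_eq_abs, pow_zero, one_mul] at h1 h2
  calc _ = ‖f x‖ + |x| ^ dunklExponent γ * ‖f x‖ := by ring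
    _ ≤ _ := by gcongr

lemma measurable_Tdunkl (γ : ℝ) {f : ℝ → ℂ} (hf : Measurable f) : Measurable (Tdunkl γ f) := by
  unfold Tdunkl
  refine Measurable.ite (measurableSet_singleton 0) measurable_const ?_
  have := measurable_deriv f
  fun_prop

lemma integral_eq_integral_Ioi_add_neg {F : ℝ → ℂ} (hF : Integrable F) :
    ∫ x, F x = ∫ x in Set.Ioi (0 : ℝ), (F x + F (-x)) := by
  rw [integral_add hF.integrableOn hF.comp_neg.integrableOn, integral_comp_neg_Ioi, neg_zero,
    add_comm, intervalIntegral.integral_Iic_add_Ioi hF.integrableOn hF.integrableOn]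

/-- Antisymmetry of the Dunkl operator with respect to `|x| ^ (2 * γ) dx`. -/
lemma integral_Tdunkl_mul {γ : ℝ} (hγ : 0 < γ) {f g : ℝ → ℂ} (hf : Differentiable ℝ f)
    (hg : Differentiable ℝ g) (hfd : DunklDecay γ f) (hTfd : DunklDecay γ (Tdunkl γ f))
    {D : ℝ} (hgb : ∀ x, ‖g x‖ ≤ D) {D' : ℝ} (hTgb : ∀ x, ‖Tdunkl γ g x‖ ≤ D') :
    ∫ x : ℝ, Tdunkl γ f x * g x * ((|x| ^ (2 * γ) : ℝ) : ℂ) =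
      -∫ x : ℝ, f x * Tdunkl γ g x * ((|x| ^ (2 * γ) : ℝ) : ℂ) := by
  have hfm := hf.continuous.measurable
  have hgm := hg.continuous.measurable
  have i1 := hTfd.integrable_mul hγ (measurable_Tdunkl γ hfm) hgm hgb
  have i2 := hfd.integrable_mul hγ hfm (measurable_Tdunkl γ hgm) hTgb
  have i3 : Integrable fun x : ℝ => Tdunkl γ f x * g x * ((|x| ^ (2 * γ) : ℝ) : ℂ) +
      f x * Tdunkl γ g x * ((|x| ^ (2 * γ) : ℝ) : ℂ) := i1.add i2
  rw [eq_neg_iff_add_eq_zero, ← integral_add i1 i2, integral_eq_integral_Ioi_add_neg i3]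
  set K : ℝ → ℂ := fun x => (f x * g x - f (-x) * g (-x)) * ((|x| ^ (2 * γ) : ℝ) : ℂ) with hK
  have hcont : Continuous K := by
    have := continuous_dunklWeight hγ
    have := hf.continuous
    have := hg.continuous
    fun_prop
  have hK0 : K 0 = 0 := by simp [hK]
  have hlim : Tendsto K atTop (nhds 0) := by
    obtain ⟨C, hC⟩ := hfd.norm_mul_weight_le hγ
    have hb : ∀ x, ‖K x‖ ≤ 2 * (D * (C * (1 + x ^ 2)⁻¹)) := by
      intro x
      have hD : 0 ≤ D := (norm_nonneg _).trans (hgb x)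
      have hw : 0 ≤ |x| ^ (2 * γ) := by positivity
      have h1 : ∀ y, |y| = |x| → ‖f y‖ * ‖g y‖ * |x| ^ (2 * γ) ≤ D * (C * (1 + x ^ 2)⁻¹) := by
        intro y hy
        have := hC y
        rw [hy, ← sq_abs, hy, sq_abs] at this
        calc ‖f y‖ * ‖g y‖ * |x| ^ (2 * γ) = ‖g y‖ * (‖f y‖ * |x| ^ (2 * γ)) := by ring
          _ ≤ _ := mul_le_mul (hgb y) this (by positivity) hD
      calc ‖K x‖ ≤ (‖f x‖ * ‖g x‖ + ‖f (-x)‖ * ‖g (-x)‖) * |x| ^ (2 * γ) := by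
            rw [hK, norm_mul, Complex.norm_real, Real.norm_of_nonneg hw]
            gcongr
            refine (norm_sub_le _ _).trans_eq ?_
            rw [norm_mul, norm_mul]
        _ = ‖f x‖ * ‖g x‖ * |x| ^ (2 * γ) + ‖f (-x)‖ * ‖g (-x)‖ * |x| ^ (2 * γ) := by ring
        _ ≤ _ := (add_le_add (h1 x rfl) (h1 (-x) (abs_neg x))).trans_eq (two_mul _).symm
    refine squeeze_zero_norm hb ?_
    have : Tendsto (fun x : ℝ => (1 + x ^ 2)⁻¹) atTop (nhds 0) :=
      tendsto_inv_atTop_zero.comp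
        (tendsto_atTop_add_const_left _ _ (tendsto_pow_atTop two_ne_zero))
    simpa using ((this.const_mul C).const_mul D).const_mul 2
  have hder : ∀ x ∈ Set.Ioi (0 : ℝ), HasDerivAt K
      ((Tdunkl γ f x * g x * ((|x| ^ (2 * γ) : ℝ) : ℂ) + f x * Tdunkl γ g x *
          ((|x| ^ (2 * γ) : ℝ) : ℂ)) +
        (Tdunkl γ f (-x) * g (-x) * ((|-x| ^ (2 * γ) : ℝ) : ℂ) + f (-x) * Tdunkl γ g (-x) *
          ((|-x| ^ (2 * γ) : ℝ) : ℂ))) x := by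
    intro x hx
    have hx0 : (0 : ℝ) < x := hx
    have hw : HasDerivAt (fun x : ℝ => ((|x| ^ (2 * γ) : ℝ) : ℂ))
        ((2 * γ * x ^ (2 * γ) / x : ℝ) : ℂ) x := by
      have h := (Real.hasDerivAt_rpow_const (x := x) (p := 2 * γ) (Or.inl hx0.ne')).ofReal_comp
      rw [Real.rpow_sub_one hx0.ne', ← mul_div_assoc] at h
      refine h.congr_of_eventuallyEq ?_
      filter_upwards [lt_mem_nhds hx0] with y hy
      rw [abs_of_pos hy]
    have hfx := (hf x).hasDerivAt
    have hgx := (hg x).hasDerivAt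
    have hfn := (hf (-x)).hasDerivAt.scomp x (hasDerivAt_neg x)
    have hgn := (hg (-x)).hasDerivAt.scomp x (hasDerivAt_neg x)
    refine HasDerivAt.congr_deriv (((hfx.mul hgx).sub (hfn.mul hgn)).mul hw) ?_
    have hxc : (x : ℂ) ≠ 0 := by exact_mod_cast hx0.ne'
    simp only [Tdunkl, hx0.ne', neg_eq_zero, if_false, abs_neg, abs_of_pos hx0, neg_neg,
      Function.comp_apply, Pi.mul_apply, Pi.sub_apply]
    push_cast
    simp only [neg_smul, one_smul]
    field_simp
    ring
  have hint := integral_Ioi_of_hasDerivAt_of_tendsto hcont.continuousWithinAt hder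
    (i3.add i3.comp_neg).integrableOn hlim
  simpa [hK0] using hint

/-- Reflection of Schwartz functions. -/
def schwartzRefl : 𝓢(ℝ, ℂ) →L[ℂ] 𝓢(ℝ, ℂ) :=
  compCLMOfContinuousLinearEquiv ℂ (ContinuousLinearEquiv.neg ℝ)

@[simp] lemma schwartzRefl_apply (f : 𝓢(ℝ, ℂ)) (x : ℝ) : schwartzRefl f x = f (-x) := rfl

/-- Multiplication of Schwartz functions by the coordinate. -/
def schwartzMulX : 𝓢(ℝ, ℂ) →L[ℂ] 𝓢(ℝ, ℂ) := smulLeftCLM ℂ fun x : ℝ => (x : ℂ)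

@[simp] lemma schwartzMulX_apply (f : 𝓢(ℝ, ℂ)) (x : ℝ) : schwartzMulX f x = x * f x := by
  rw [schwartzMulX, smulLeftCLM_apply_apply (by fun_prop), smul_eq_mul]

lemma SchwartzMap.exists_coe_eq_Tdunkl (γ : ℝ) (f : 𝓢(ℝ, ℂ)) :
    ∃ h : 𝓢(ℝ, ℂ), ⇑h = Tdunkl γ f := by
  obtain ⟨q, hq⟩ := SchwartzMap.exists_ofReal_mul_eq (f - schwartzRefl f) (by simp)
  have hq0 : q 0 = 2 * deriv f 0 := by
    have hx : HasDerivAt (fun x : ℝ => (x : ℂ)) 1 0 := Complex.ofRealCLM.hasDerivAt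
    have h1 := hx.mul q.differentiableAt.hasDerivAt
    have hf : HasDerivAt f (deriv f 0) 0 := f.differentiableAt.hasDerivAt
    have hf' : HasDerivAt f (deriv f 0) (-0) := by rwa [neg_zero]
    have h2 := hf.sub (hf'.scomp (0 : ℝ) (hasDerivAt_neg (0 : ℝ)))
    have h3 : ((fun x : ℝ => (x : ℂ)) * ⇑q) = (⇑f - ⇑f ∘ Neg.neg) := by
      ext x; simpa using hq x
    rw [h3] at h1
    have := h1.unique h2
    simp at this
    rw [this]; ring
  refine ⟨derivCLM ℂ ℂ f + (γ : ℂ) • q, ?_⟩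
  ext x
  rw [Tdunkl]
  split_ifs with hx
  · subst hx
    simp [hq0]; ring
  · have hx' : (x : ℂ) ≠ 0 := by exact_mod_cast hx
    have := hq x
    simp at this
    rw [← this]
    simp
    field_simp

/-- The Dunkl operator on Schwartz functions. -/
def schwartzDunkl (γ : ℝ) : 𝓢(ℝ, ℂ) →ₗ[ℂ] 𝓢(ℝ, ℂ) where
  toFun f := (SchwartzMap.exists_coe_eq_Tdunkl γ f).choose
  map_add' f g := by
    ext x
    rw [add_apply, (SchwartzMap.exists_coe_eq_Tdunkl γ (f + g)).choose_spec,
      (SchwartzMap.exists_coe_eq_Tdunkl γ f).choose_spec,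
      (SchwartzMap.exists_coe_eq_Tdunkl γ g).choose_spec]
    have h : ∀ y, deriv (⇑(f + g)) y = deriv f y + deriv g y := fun y =>
      deriv_add f.differentiableAt g.differentiableAt
    simp only [Tdunkl, h, add_apply]
    split_ifs <;> ring
  map_smul' c f := by
    ext x
    rw [smul_apply, (SchwartzMap.exists_coe_eq_Tdunkl γ (c • f)).choose_spec,
      (SchwartzMap.exists_coe_eq_Tdunkl γ f).choose_spec]
    have h : ∀ y, deriv (⇑(c • f)) y = c * deriv f y := fun y =>
      deriv_const_mul c f.differentiableAt
    simp only [Tdunkl, h, smul_apply, smul_eq_mul, RingHom.id_apply]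
    split_ifs <;> ring

lemma coe_schwartzDunkl (γ : ℝ) (f : 𝓢(ℝ, ℂ)) : ⇑(schwartzDunkl γ f) = Tdunkl γ f :=
  (SchwartzMap.exists_coe_eq_Tdunkl γ f).choose_spec

lemma coe_schwartzDunkl_iterate (γ : ℝ) (n : ℕ) (f : 𝓢(ℝ, ℂ)) :
    ⇑((schwartzDunkl γ)^[n] f) = (Tdunkl γ)^[n] f := by
  induction n generalizing f with
  | zero => rfl
  | succ n ih => rw [Function.iterate_succ_apply, Function.iterate_succ_apply, ih,
      coe_schwartzDunkl]

lemma FDunkl_eq (γ : ℝ) (f : ℝ → ℂ) (lam : ℝ) :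
    FDunkl γ f lam = ∫ x : ℝ, f x * dunklExp γ (lam * x) * ((|x| ^ (2 * γ) : ℝ) : ℂ) := by
  simp only [FDunkl, Ekern_eq]

lemma hasDerivAt_dunklExp_mul {γ : ℝ} (hγ : 0 < γ) (lam x : ℝ) :
    HasDerivAt (fun x => dunklExp γ (lam * x)) (lam * dunklExpDeriv γ (lam * x)) x := by
  have h := (hasDerivAt_dunklExp hγ (lam * x)).scomp x ((hasDerivAt_id x).const_mul lam)
  exact HasDerivAt.congr_deriv h (by simp)

lemma Tdunkl_dunklExp_mul {γ : ℝ} (hγ : 0 < γ) (lam : ℝ) :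
    Tdunkl γ (fun x => dunklExp γ (lam * x)) =
      fun x => -Complex.I * lam * dunklExp γ (lam * x) := by
  ext x
  rw [Tdunkl, (hasDerivAt_dunklExp_mul hγ lam 0).deriv, (hasDerivAt_dunklExp_mul hγ lam x).deriv]
  split_ifs with hx
  · subst hx
    rw [mul_zero, dunklExp_zero hγ]
    linear_combination (lam : ℂ) * dunklExpDeriv_zero hγ
  · rcases eq_or_ne lam 0 with rfl | hl
    · simp
    have h := dunklExpDeriv_add hγ (mul_ne_zero hl hx)
    have hx' : (x : ℂ) ≠ 0 := by exact_mod_cast hx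
    have hl' : (lam : ℂ) ≠ 0 := by exact_mod_cast hl
    rw [mul_neg]
    push_cast at h
    field_simp at h ⊢
    linear_combination h

lemma FDunkl_Tdunkl {γ : ℝ} (hγ : 0 < γ) {f : ℝ → ℂ} (hf : Differentiable ℝ f)
    (hfd : DunklDecay γ f) (hTfd : DunklDecay γ (Tdunkl γ f)) (lam : ℝ) :
    FDunkl γ (Tdunkl γ f) lam = Complex.I * lam * FDunkl γ f lam := by
  rw [FDunkl_eq, integral_Tdunkl_mul hγ (g := fun x => dunklExp γ (lam * x)) hf
    (fun x => (hasDerivAt_dunklExp_mul hγ lam x).differentiableAt) hfd hTfd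
    (fun x => norm_dunklExp_le hγ _) (D' := |lam|), Tdunkl_dunklExp_mul hγ, FDunkl_eq,
    ← integral_neg, ← integral_const_mul]
  · congr 1; ext x; ring
  · intro x
    rw [Tdunkl_dunklExp_mul hγ, norm_mul, norm_mul, norm_neg, Complex.norm_I, one_mul,
      Complex.norm_real]
    exact mul_le_of_le_one_right (norm_nonneg _) (norm_dunklExp_le hγ _)

lemma norm_FDunkl_le {γ : ℝ} (hγ : 0 < γ) {f : ℝ → ℂ} (hfd : DunklDecay γ f)
    (hfm : Measurable f) (lam : ℝ) :
    ‖FDunkl γ f lam‖ ≤ ∫ x : ℝ, ‖f x‖ * |x| ^ (2 * γ) := by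
  have hi := (hfd.integrable hγ hfm).norm
  have hn : ∀ x : ℝ, ‖f x * ((|x| ^ (2 * γ) : ℝ) : ℂ)‖ = ‖f x‖ * |x| ^ (2 * γ) := fun x => by
    rw [norm_mul, Complex.norm_real, Real.norm_of_nonneg (by positivity)]
  simp only [hn] at hi
  rw [FDunkl_eq]
  refine norm_integral_le_of_norm_le hi (Eventually.of_forall fun x => ?_)
  rw [mul_right_comm, norm_mul, hn]
  exact mul_le_of_le_one_right (by positivity) (norm_dunklExp_le hγ _)

lemma FDunkl_schwartzDunkl {γ : ℝ} (hγ : 0 < γ) (f : 𝓢(ℝ, ℂ)) (lam : ℝ) :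
    FDunkl γ (schwartzDunkl γ f) lam = Complex.I * lam * FDunkl γ f lam := by
  rw [coe_schwartzDunkl]
  refine FDunkl_Tdunkl hγ f.differentiable (f.dunklDecay γ) ?_ lam
  rw [← coe_schwartzDunkl]
  exact SchwartzMap.dunklDecay γ _

lemma FDunkl_schwartzDunkl_iterate {γ : ℝ} (hγ : 0 < γ) (n : ℕ) (f : 𝓢(ℝ, ℂ)) (lam : ℝ) :
    FDunkl γ ((schwartzDunkl γ)^[n] f) lam = (Complex.I * lam) ^ n * FDunkl γ f lam := by
  induction n with
  | zero => simp
  | succ n ih => rw [Function.iterate_succ_apply', FDunkl_schwartzDunkl hγ, ih]; ring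

lemma dunklDecay_FDunkl {γ : ℝ} (hγ : 0 < γ) (f : 𝓢(ℝ, ℂ)) : DunklDecay γ (FDunkl γ f) := by
  set g := (schwartzDunkl γ)^[dunklExponent γ] f
  refine ⟨(∫ x : ℝ, ‖f x‖ * |x| ^ (2 * γ)) + ∫ x : ℝ, ‖g x‖ * |x| ^ (2 * γ), fun lam => ?_⟩
  have h1 := norm_FDunkl_le hγ (f.dunklDecay γ) f.continuous.measurable lam
  have h2 := norm_FDunkl_le hγ (g.dunklDecay γ) g.continuous.measurable lam
  rw [FDunkl_schwartzDunkl_iterate hγ, norm_mul, norm_pow, norm_mul, Complex.norm_I, one_mul,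
    Complex.norm_real, Real.norm_eq_abs] at h2
  linarith

lemma SchwartzMap.integrable_mul_dunklExp {γ : ℝ} (hγ : 0 < γ) (f : 𝓢(ℝ, ℂ)) (l : ℝ) :
    Integrable fun x : ℝ => f x * dunklExp γ (l * x) * ((|x| ^ (2 * γ) : ℝ) : ℂ) :=
  (f.dunklDecay γ).integrable_mul hγ f.continuous.measurable
    ((continuous_dunklExp hγ).comp (continuous_const_mul l)).measurable
    (fun _ => norm_dunklExp_le hγ _)

lemma SchwartzMap.integrable_mul_dunklExpDeriv {γ : ℝ} (hγ : 0 < γ) (f : 𝓢(ℝ, ℂ)) (l : ℝ) :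
    Integrable fun x : ℝ => f x * dunklExpDeriv γ (l * x) * ((|x| ^ (2 * γ) : ℝ) : ℂ) :=
  (f.dunklDecay γ).integrable_mul hγ f.continuous.measurable
    ((continuous_dunklExpDeriv hγ).comp (continuous_const_mul l)).measurable
    (fun _ => norm_dunklExpDeriv_le hγ _)

lemma hasDerivAt_FDunkl {γ : ℝ} (hγ : 0 < γ) (f : 𝓢(ℝ, ℂ)) (lam : ℝ) :
    HasDerivAt (FDunkl γ f) (∫ x : ℝ, schwartzMulX f x * dunklExpDeriv γ (lam * x) *
      ((|x| ^ (2 * γ) : ℝ) : ℂ)) lam := by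
  have hi1 := f.integrable_mul_dunklExp hγ
  have hi2 := (schwartzMulX f).integrable_mul_dunklExpDeriv hγ lam
  rw [show FDunkl γ f = _ from funext (FDunkl_eq γ f)]
  refine (hasDerivAt_integral_of_dominated_loc_of_deriv_le (s := Set.univ) univ_mem
    (F := fun l x => f x * dunklExp γ (l * x) * ((|x| ^ (2 * γ) : ℝ) : ℂ))
    (F' := fun l x => schwartzMulX f x * dunklExpDeriv γ (l * x) * ((|x| ^ (2 * γ) : ℝ) : ℂ))
    (bound := fun x => 3 * ‖schwartzMulX f x * ((|x| ^ (2 * γ) : ℝ) : ℂ)‖)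
    (Eventually.of_forall fun l => (hi1 l).aestronglyMeasurable) (hi1 lam)
    hi2.aestronglyMeasurable (Eventually.of_forall fun x l _ => ?_)
    ((((schwartzMulX f).dunklDecay γ).integrable hγ
      (schwartzMulX f).continuous.measurable).norm.const_mul 3)
    (Eventually.of_forall fun x l _ => ?_)).2
  · rw [mul_right_comm, norm_mul, mul_comm]
    gcongr
    exact norm_dunklExpDeriv_le hγ _
  · have h := hasDerivAt_dunklExp_mul hγ x l
    simp only [mul_comm x] at h
    refine HasDerivAt.congr_deriv ((h.const_mul (f x)).mul_const _) ?_
    rw [schwartzMulX_apply]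
    ring

lemma Tdunkl_FDunkl {γ : ℝ} (hγ : 0 < γ) (f : 𝓢(ℝ, ℂ)) :
    Tdunkl γ (FDunkl γ f) = fun lam => -Complex.I * FDunkl γ (schwartzMulX f) lam := by
  have hi1 := f.integrable_mul_dunklExp hγ
  have hi2 := (schwartzMulX f).integrable_mul_dunklExpDeriv hγ
  ext lam
  rw [Tdunkl, (hasDerivAt_FDunkl hγ f _).deriv, (hasDerivAt_FDunkl hγ f _).deriv]
  split_ifs with hl
  · subst hl
    rw [FDunkl_eq, ← integral_const_mul, ← integral_const_mul]
    congr 1; ext x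
    rw [zero_mul, dunklExp_zero hγ]
    linear_combination (schwartzMulX f x * ((|x| ^ (2 * γ) : ℝ) : ℂ)) * dunklExpDeriv_zero hγ
  · have hi3 : Integrable fun x : ℝ =>
        (γ : ℂ) * (f x * dunklExp γ (lam * x) * ((|x| ^ (2 * γ) : ℝ) : ℂ) -
          f x * dunklExp γ (-lam * x) * ((|x| ^ (2 * γ) : ℝ) : ℂ)) / lam :=
      (((hi1 lam).sub (hi1 (-lam))).const_mul _).div_const _
    rw [FDunkl_eq, FDunkl_eq, FDunkl_eq, ← integral_sub (hi1 _) (hi1 _), ← integral_const_mul,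
      ← integral_div, ← integral_add (hi2 _) hi3, ← integral_const_mul]
    congr 1; ext x
    rw [schwartzMulX_apply]
    rcases eq_or_ne x 0 with rfl | hx
    · simp
    have h := dunklExpDeriv_add hγ (mul_ne_zero hl hx)
    have hx' : (x : ℂ) ≠ 0 := by exact_mod_cast hx
    have hl' : (lam : ℂ) ≠ 0 := by exact_mod_cast hl
    rw [neg_mul lam x]
    push_cast at h
    generalize ((|x| ^ (2 * γ) : ℝ) : ℂ) = W
    field_simp at h ⊢
    linear_combination W * f x * h

lemma abs_pow_mul_gaussian_le (k : ℕ) (x : ℝ) :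
    |x| ^ k * Real.exp (-(x ^ 2 / 2)) ≤ k.factorial * Real.exp (1 / 2) := by
  have h := Real.pow_div_factorial_le_exp |x| (abs_nonneg x) k
  rw [div_le_iff₀ (by positivity)] at h
  calc |x| ^ k * Real.exp (-(x ^ 2 / 2))
      ≤ Real.exp |x| * k.factorial * Real.exp (-(x ^ 2 / 2)) := by gcongr
    _ = k.factorial * Real.exp (|x| + -(x ^ 2 / 2)) := by rw [Real.exp_add]; ring
    _ ≤ k.factorial * Real.exp (1 / 2) := by
      gcongr
      nlinarith [sq_nonneg (|x| - 1), sq_abs x]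

lemma exists_abs_pow_mul_aeval_mul_gaussian_le (q : Polynomial ℤ) :
    ∀ k : ℕ, ∃ C : ℝ, ∀ x : ℝ,
      |x| ^ k * (|Polynomial.aeval x q| * Real.exp (-(x ^ 2 / 2))) ≤ C := by
  induction q using Polynomial.induction_on' with
  | add p q hp hq =>
    intro k
    obtain ⟨C, hC⟩ := hp k
    obtain ⟨D, hD⟩ := hq k
    refine ⟨C + D, fun x => (?_ : _ ≤ _).trans (add_le_add (hC x) (hD x))⟩
    rw [map_add, ← mul_add, ← add_mul]
    gcongr
    exact abs_add_le _ _
  | monomial n a =>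
    intro k
    refine ⟨|(a : ℝ)| * ((k + n).factorial * Real.exp (1 / 2)), fun x => ?_⟩
    have h := mul_le_mul_of_nonneg_left (abs_pow_mul_gaussian_le (k + n) x) (abs_nonneg (a : ℝ))
    refine le_of_eq_of_le ?_ h
    rw [Polynomial.aeval_monomial, abs_mul, abs_pow, pow_add]
    simp only [eq_intCast]
    ring

/-- The standard Gaussian as a Schwartz function. -/
def schwartzGaussian : 𝓢(ℝ, ℂ) :=
  postcompCLM Complex.ofRealCLM
    { toFun := fun x : ℝ => Real.exp (-(x ^ 2 / 2))
      smooth' := by fun_prop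
      decay' := fun k n => by
        obtain ⟨C, hC⟩ := exists_abs_pow_mul_aeval_mul_gaussian_le (Polynomial.hermite n) k
        refine ⟨C, fun x => le_of_eq_of_le ?_ (hC x)⟩
        rw [norm_iteratedFDeriv_eq_norm_iteratedDeriv, iteratedDeriv_eq_iterate,
          Polynomial.deriv_gaussian_eq_hermite_mul_gaussian, Real.norm_eq_abs, Real.norm_eq_abs,
          abs_mul, abs_mul, abs_pow, abs_neg, abs_one, one_pow, one_mul, Real.abs_exp] }

lemma schwartzGaussian_apply (x : ℝ) :
    schwartzGaussian x = (Real.exp (-(x ^ 2 / 2)) : ℝ) := rfl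

lemma FDunkl_schwartzRefl (γ : ℝ) (f : 𝓢(ℝ, ℂ)) (lam : ℝ) :
    FDunkl γ (schwartzRefl f) lam = FDunkl γ f (-lam) := by
  rw [FDunkl_eq, FDunkl_eq,
    ← integral_neg_eq_self (fun x => f x * dunklExp γ (-lam * x) * ((|x| ^ (2 * γ) : ℝ) : ℂ))]
  simp

lemma Tdunkl_of_even {γ : ℝ} {f : ℝ → ℂ} (hf : ∀ x, f (-x) = f x) (x : ℝ) :
    Tdunkl γ f x = deriv f x := by
  rw [Tdunkl]
  split_ifs with hx
  · have h : deriv f 0 = 0 := by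
      have h := deriv_comp_neg f 0
      rw [show (fun x => f (-x)) = f from funext hf, neg_zero] at h
      exact self_eq_neg.1 h
    rw [hx, h, mul_zero]
  · rw [hf, sub_self, mul_zero, zero_div, add_zero]

lemma hasDerivAt_gaussian (x : ℝ) :
    HasDerivAt (fun x : ℝ => Real.exp (-(x ^ 2 / 2))) (-(x * Real.exp (-(x ^ 2 / 2)))) x := by
  have h : HasDerivAt (fun x : ℝ => -(x ^ 2 / 2)) (-x) x := by
    have := ((hasDerivAt_pow 2 x).div_const 2).neg
    exact this.congr_deriv (by simp)
  exact h.exp.congr_deriv (by ring)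

lemma hasDerivAt_schwartzGaussian (x : ℝ) :
    HasDerivAt schwartzGaussian (-(x * schwartzGaussian x)) x := by
  have h := (hasDerivAt_gaussian x).ofReal_comp
  rw [schwartzGaussian_apply]
  refine HasDerivAt.congr_deriv h ?_
  push_cast; ring

lemma schwartzGaussian_neg (x : ℝ) : schwartzGaussian (-x) = schwartzGaussian x := by
  simp [schwartzGaussian_apply]

lemma schwartzDunkl_schwartzGaussian (γ : ℝ) :
    schwartzDunkl γ schwartzGaussian = -schwartzMulX schwartzGaussian := by
  ext x
  rw [coe_schwartzDunkl, Tdunkl_of_even schwartzGaussian_neg,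
    (hasDerivAt_schwartzGaussian x).deriv, neg_apply, schwartzMulX_apply]

lemma FDunkl_neg (γ : ℝ) (f : 𝓢(ℝ, ℂ)) (lam : ℝ) :
    FDunkl γ (-f : 𝓢(ℝ, ℂ)) lam = -FDunkl γ f lam := by
  rw [FDunkl_eq, FDunkl_eq, ← integral_neg]
  congr 1; ext x; rw [neg_apply]; ring

lemma FDunkl_schwartzGaussian {γ : ℝ} (hγ : 0 < γ) (lam : ℝ) :
    FDunkl γ schwartzGaussian lam =
      FDunkl γ schwartzGaussian 0 * schwartzGaussian lam := by
  set F := FDunkl γ schwartzGaussian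
  have heven : ∀ x, F (-x) = F x := fun x => by
    rw [show F (-x) = _ from (FDunkl_schwartzRefl γ schwartzGaussian x).symm,
      show schwartzRefl schwartzGaussian = schwartzGaussian from
      SchwartzMap.ext fun x => by simp [schwartzGaussian_neg]]
  have hderiv : ∀ x, HasDerivAt F (-(x * F x)) x := fun x => by
    have h1 := (hasDerivAt_FDunkl hγ schwartzGaussian x).differentiableAt.hasDerivAt
    refine h1.congr_deriv ?_
    have h2 := congrFun (Tdunkl_FDunkl hγ schwartzGaussian) x
    rw [Tdunkl_of_even heven] at h2
    have h3 := FDunkl_schwartzDunkl hγ schwartzGaussian x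
    rw [schwartzDunkl_schwartzGaussian, FDunkl_neg] at h3
    rw [h2]
    linear_combination Complex.I * h3 + (x : ℂ) * F x * Complex.I_sq
  have hexp : ∀ x : ℝ, HasDerivAt (fun x : ℝ => ((Real.exp (x ^ 2 / 2) : ℝ) : ℂ))
      (x * (Real.exp (x ^ 2 / 2) : ℝ)) x := fun x => by
    have h : HasDerivAt (fun x : ℝ => x ^ 2 / 2) x x := by
      have := (hasDerivAt_pow 2 x).div_const 2
      exact this.congr_deriv (by simp)
    refine HasDerivAt.congr_deriv h.exp.ofReal_comp ?_
    push_cast; ring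
  have hconst := is_const_of_deriv_eq_zero
    (f := fun x : ℝ => F x * ((Real.exp (x ^ 2 / 2) : ℝ) : ℂ))
    (fun x => ((hderiv x).mul (hexp x)).differentiableAt)
    (fun x => (((hderiv x).mul (hexp x)).congr_deriv (by ring)).deriv) lam 0
  have h0 : ((Real.exp ((0 : ℝ) ^ 2 / 2) : ℝ) : ℂ) = 1 := by simp
  have hmul : ((Real.exp (lam ^ 2 / 2) : ℝ) : ℂ) * (Real.exp (-(lam ^ 2 / 2)) : ℝ) = 1 := by
    rw [← Complex.ofReal_mul, ← Real.exp_add, add_neg_cancel, Real.exp_zero, Complex.ofReal_one]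
  simp only [h0, mul_one] at hconst
  rw [← hconst, schwartzGaussian_apply, mul_assoc, hmul, mul_one]

lemma FDunkl_schwartzGaussian_zero_ne {γ : ℝ} (hγ : 0 < γ) :
    FDunkl γ schwartzGaussian 0 ≠ 0 := by
  have hval : FDunkl γ schwartzGaussian 0 =
      ((∫ x : ℝ, Real.exp (-(x ^ 2 / 2)) * |x| ^ (2 * γ) : ℝ) : ℂ) := by
    rw [FDunkl_eq, ← integral_complex_ofReal]
    congr 1; ext x
    rw [zero_mul, dunklExp_zero hγ, schwartzGaussian_apply, mul_one, ← Complex.ofReal_mul]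
  rw [hval, Complex.ofReal_ne_zero]
  have hi := ((schwartzGaussian.dunklDecay γ).integrable hγ
    schwartzGaussian.continuous.measurable).norm
  have hn : ∀ x : ℝ, ‖schwartzGaussian x * ((|x| ^ (2 * γ) : ℝ) : ℂ)‖ =
      Real.exp (-(x ^ 2 / 2)) * |x| ^ (2 * γ) := fun x => by
    rw [schwartzGaussian_apply, ← Complex.ofReal_mul, Complex.norm_real,
      Real.norm_of_nonneg (by positivity)]
  simp only [hn] at hi
  refine ne_of_gt (integral_pos_of_integrable_nonneg_nonzero (x := 1) ?_ hi
    (fun x => by positivity) (by simp))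
  exact (by fun_prop : Continuous fun x : ℝ => Real.exp (-(x ^ 2 / 2))).mul
    (continuous_abs.rpow_const fun _ => Or.inr (by positivity))

lemma continuous_FDunkl {γ : ℝ} (hγ : 0 < γ) (f : 𝓢(ℝ, ℂ)) : Continuous (FDunkl γ f) :=
  continuous_iff_continuousAt.2 fun x => (hasDerivAt_FDunkl hγ f x).continuousAt

lemma DunklDecay.integrable_mul_dunklExp {γ : ℝ} (hγ : 0 < γ) {f : ℝ → ℂ}
    (hf : DunklDecay γ f) (hfm : Measurable f) (lam : ℝ) :
    Integrable fun x : ℝ => f x * dunklExp γ (lam * x) * ((|x| ^ (2 * γ) : ℝ) : ℂ) :=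
  hf.integrable_mul hγ hfm
    ((continuous_dunklExp hγ).comp (continuous_const_mul lam)).measurable
    (fun _ => norm_dunklExp_le hγ _)

lemma FDunkl_sub_const_mul {γ : ℝ} (hγ : 0 < γ) {f g : ℝ → ℂ} (hf : DunklDecay γ f)
    (hfm : Measurable f) (hg : DunklDecay γ g) (hgm : Measurable g) (c : ℂ) (lam : ℝ) :
    FDunkl γ (fun x => f x - c * g x) lam = FDunkl γ f lam - c * FDunkl γ g lam := by
  rw [FDunkl_eq, FDunkl_eq, FDunkl_eq, ← integral_const_mul,
    ← integral_sub (hf.integrable_mul_dunklExp hγ hfm lam)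
      ((hg.integrable_mul_dunklExp hγ hgm lam).const_mul c)]
  congr 1; ext x; ring

lemma SchwartzMap.exists_sub_mul_eq (h : 𝓢(ℝ, ℂ)) {a : ℝ} (ha : h a = 0) :
    ∃ g : 𝓢(ℝ, ℂ), ∀ x : ℝ, h x = x * g x - a * g x := by
  obtain ⟨q, hq⟩ := SchwartzMap.exists_ofReal_mul_eq (h.compSubConstCLM ℂ (-a))
    (by simp [compSubConstCLM_apply, ha])
  refine ⟨q.compSubConstCLM ℂ a, fun x => ?_⟩
  have := hq (x - a)
  rw [compSubConstCLM_apply, sub_neg_eq_add, sub_add_cancel] at this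
  rw [← this, compSubConstCLM_apply]
  push_cast; ring

lemma FDunkl_FDunkl_eq_zero {γ : ℝ} (hγ : 0 < γ) (h : 𝓢(ℝ, ℂ)) {a : ℝ} (ha : h a = 0) :
    FDunkl γ (FDunkl γ h) (-a) = 0 := by
  obtain ⟨g, hg⟩ := h.exists_sub_mul_eq ha
  have hdiff : Differentiable ℝ (FDunkl γ g) := fun x =>
    (hasDerivAt_FDunkl hγ g x).differentiableAt
  have hTd : DunklDecay γ (Tdunkl γ (FDunkl γ g)) := by
    obtain ⟨C, hC⟩ := dunklDecay_FDunkl hγ (schwartzMulX g)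
    refine ⟨C, fun x => ?_⟩
    rw [Tdunkl_FDunkl hγ, norm_mul, norm_neg, Complex.norm_I, one_mul]
    exact hC x
  have hF : FDunkl γ h = fun lam =>
      FDunkl γ (schwartzMulX g) lam - (a : ℂ) * FDunkl γ g lam := by
    ext lam
    rw [← FDunkl_sub_const_mul hγ ((schwartzMulX g).dunklDecay γ)
      (schwartzMulX g).continuous.measurable (g.dunklDecay γ) g.continuous.measurable]
    congr 1; ext x
    rw [hg, schwartzMulX_apply]
  have hint := FDunkl_Tdunkl hγ hdiff (dunklDecay_FDunkl hγ g) hTd (-a)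
  have hM : FDunkl γ (schwartzMulX g) = fun lam => 0 - -Complex.I * Tdunkl γ (FDunkl γ g) lam := by
    ext lam
    rw [Tdunkl_FDunkl hγ]
    linear_combination (FDunkl γ (schwartzMulX g) lam) * Complex.I_sq
  have h0 : FDunkl γ (fun _ => 0) (-a) = 0 := by rw [FDunkl_eq]; simp
  have hz : DunklDecay γ fun _ => 0 := ⟨0, fun x => by simp⟩
  rw [hF, FDunkl_sub_const_mul hγ (dunklDecay_FDunkl hγ _) (continuous_FDunkl hγ _).measurable
    (dunklDecay_FDunkl hγ _) (continuous_FDunkl hγ _).measurable, hM,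
    FDunkl_sub_const_mul hγ hz measurable_const hTd (measurable_Tdunkl γ (continuous_FDunkl hγ g).measurable), hint, h0]
  push_cast
  linear_combination (-a * FDunkl γ (FDunkl γ g) (-a)) * Complex.I_sq

/-- Inversion formula for the Dunkl transform, up to the value of the constant. -/
lemma FDunkl_FDunkl {γ : ℝ} (hγ : 0 < γ) (h : 𝓢(ℝ, ℂ)) (a : ℝ) :
    FDunkl γ (FDunkl γ h) (-a) = FDunkl γ schwartzGaussian 0 ^ 2 * h a := by
  set κ := FDunkl γ schwartzGaussian 0 with hκ
  have hG : schwartzGaussian a ≠ 0 := by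
    rw [schwartzGaussian_apply]; exact_mod_cast (Real.exp_pos _).ne'
  set c : ℂ := h a / schwartzGaussian a with hc
  have hz := FDunkl_FDunkl_eq_zero hγ (h - c • schwartzGaussian) (a := a) (by
    rw [sub_apply, smul_apply, smul_eq_mul, hc, div_mul_cancel₀ _ hG, sub_self])
  have h1 : FDunkl γ (h - c • schwartzGaussian : 𝓢(ℝ, ℂ)) =
      fun lam => FDunkl γ h lam - c * FDunkl γ schwartzGaussian lam := by
    ext lam
    rw [← FDunkl_sub_const_mul hγ (h.dunklDecay γ) h.continuous.measurable
      (schwartzGaussian.dunklDecay γ) schwartzGaussian.continuous.measurable]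
    rfl
  have h2 : FDunkl γ (FDunkl γ schwartzGaussian) (-a) = κ ^ 2 * schwartzGaussian a := by
    rw [show FDunkl γ schwartzGaussian = fun x => κ * schwartzGaussian x from
      funext fun x => FDunkl_schwartzGaussian hγ x]
    have h3 := FDunkl_schwartzGaussian hγ (-a)
    rw [schwartzGaussian_neg] at h3
    rw [sq, mul_assoc, ← h3, FDunkl_eq, FDunkl_eq, ← integral_const_mul]
    congr 1; ext x; ring
  rw [h1, FDunkl_sub_const_mul hγ (dunklDecay_FDunkl hγ _) (continuous_FDunkl hγ _).measurable
    (dunklDecay_FDunkl hγ _) (continuous_FDunkl hγ _).measurable, h2, sub_eq_zero] at hz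
  rw [hz, hc]
  field_simp

lemma norm_le_integral_norm_FDunkl {γ : ℝ} (hγ : 0 < γ) (h : 𝓢(ℝ, ℂ)) (x : ℝ) :
    ‖h x‖ ≤ ‖FDunkl γ schwartzGaussian 0 ^ 2‖⁻¹ * ∫ l : ℝ, ‖FDunkl γ h l‖ * |l| ^ (2 * γ) := by
  have h1 := norm_FDunkl_le hγ (dunklDecay_FDunkl hγ h) (continuous_FDunkl hγ h).measurable (-x)
  have hκ : 0 < ‖FDunkl γ schwartzGaussian 0 ^ 2‖ :=
    norm_pos_iff.2 (pow_ne_zero _ (FDunkl_schwartzGaussian_zero_ne hγ))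
  rw [FDunkl_FDunkl hγ, norm_mul] at h1
  rwa [le_inv_mul_iff₀ hκ]

lemma schwartzDunkl_schwartzRefl (γ : ℝ) (f : 𝓢(ℝ, ℂ)) :
    schwartzDunkl γ (schwartzRefl f) = -schwartzRefl (schwartzDunkl γ f) := by
  ext x
  have hd : ∀ y : ℝ, deriv (schwartzRefl f) y = -deriv f (-y) := fun y => deriv_comp_neg f y
  rw [neg_apply, schwartzRefl_apply, coe_schwartzDunkl, coe_schwartzDunkl, Tdunkl, Tdunkl, hd, hd]
  simp only [schwartzRefl_apply, neg_eq_zero, neg_neg, neg_zero]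
  split_ifs with hx
  · ring
  · push_cast
    rw [div_neg]; ring

lemma schwartzMulX_schwartzDunkl (γ : ℝ) (f : 𝓢(ℝ, ℂ)) :
    schwartzMulX (schwartzDunkl γ f) =
      schwartzDunkl γ (schwartzMulX f) - f - (2 * γ : ℂ) • schwartzRefl f := by
  ext x
  have hd : ∀ y : ℝ, deriv (schwartzMulX f) y = f y + y * deriv f y := fun y => by
    have hx : HasDerivAt (fun x : ℝ => (x : ℂ)) 1 y := Complex.ofRealCLM.hasDerivAt
    have h := hx.mul f.differentiableAt.hasDerivAt
    rw [show ⇑(schwartzMulX f) = (fun x : ℝ => (x : ℂ)) * ⇑f from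
      funext fun z => schwartzMulX_apply f z, h.deriv, one_mul]
  rw [sub_apply, sub_apply, smul_apply, schwartzRefl_apply, schwartzMulX_apply, coe_schwartzDunkl,
    coe_schwartzDunkl, Tdunkl, Tdunkl, hd, hd]
  simp only [schwartzMulX_apply, smul_eq_mul]
  split_ifs with hx
  · subst hx; simp; ring
  · have : (x : ℂ) ≠ 0 := by exact_mod_cast hx
    push_cast
    field_simp
    ring

lemma schwartzMulX_schwartzDunkl_iterate (γ : ℝ) (m : ℕ) (f : 𝓢(ℝ, ℂ)) :
    schwartzMulX ((schwartzDunkl γ ^ (m + 1)) f) =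
      (schwartzDunkl γ ^ (m + 1)) (schwartzMulX f) - (m + 1 : ℂ) • (schwartzDunkl γ ^ m) f -
        (γ * (1 + (-1) ^ m) : ℂ) • (schwartzDunkl γ ^ m) (schwartzRefl f) := by
  induction m generalizing f with
  | zero =>
    rw [zero_add, pow_one, pow_zero, schwartzMulX_schwartzDunkl]
    simp only [Module.End.one_apply, Nat.cast_zero, zero_add, one_smul, pow_zero]
    congr 2; ring
  | succ m ih =>
    have h := ih (schwartzDunkl γ f)
    rw [schwartzMulX_schwartzDunkl, ← neg_eq_iff_eq_neg.2 (schwartzDunkl_schwartzRefl γ f)] at h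
    simp only [map_sub, map_smul, map_neg, ← Module.End.mul_apply, ← pow_succ] at h
    rw [h]
    push_cast
    simp only [pow_succ]
    module

/-- The Dunkl transform of `h` vanishes outside `[-R, R]`. -/
def DunklBandLimited (γ R : ℝ) (h : 𝓢(ℝ, ℂ)) : Prop :=
  ∀ l : ℝ, R < |l| → FDunkl γ h l = 0

lemma DunklBandLimited.reflect {γ R : ℝ} {h : 𝓢(ℝ, ℂ)} (hh : DunklBandLimited γ R h) :
    DunklBandLimited γ R (schwartzRefl h) := fun l hl => by
  rw [FDunkl_schwartzRefl]
  exact hh _ (by rwa [abs_neg])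

lemma DunklBandLimited.mulCoord {γ R : ℝ} (hγ : 0 < γ) (hR : 0 ≤ R) {h : 𝓢(ℝ, ℂ)}
    (hh : DunklBandLimited γ R h) : DunklBandLimited γ R (schwartzMulX h) := fun l hl => by
  have h1 := congrFun (Tdunkl_FDunkl hγ h) l
  have hl0 : l ≠ 0 := fun h0 => by rw [h0, abs_zero] at hl; linarith
  have hev : FDunkl γ h =ᶠ[nhds l] fun _ => 0 := by
    filter_upwards [(isOpen_lt continuous_const continuous_abs).mem_nhds hl] with y hy
    exact hh y hy
  rw [Tdunkl, if_neg hl0, hev.deriv_eq, hh l hl, hh (-l) (by rwa [abs_neg])] at h1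
  simpa using h1.symm

lemma DunklBandLimited.norm_iterate_le {γ R : ℝ} (hγ : 0 < γ) {h : 𝓢(ℝ, ℂ)}
    (hh : DunklBandLimited γ R h) :
    ∃ C, 0 ≤ C ∧ ∀ (m : ℕ) (x : ℝ), ‖(schwartzDunkl γ ^ m) h x‖ ≤ C * R ^ m := by
  have hi := ((dunklDecay_FDunkl hγ h).integrable hγ (continuous_FDunkl hγ h).measurable).norm
  have hn : ∀ x : ℝ, ‖FDunkl γ h x * ((|x| ^ (2 * γ) : ℝ) : ℂ)‖ =
      ‖FDunkl γ h x‖ * |x| ^ (2 * γ) := fun x => by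
    rw [norm_mul, Complex.norm_real, Real.norm_of_nonneg (by positivity)]
  simp only [hn] at hi
  refine ⟨‖FDunkl γ schwartzGaussian 0 ^ 2‖⁻¹ * ∫ l : ℝ, ‖FDunkl γ h l‖ * |l| ^ (2 * γ),
    by positivity, fun m x => (norm_le_integral_norm_FDunkl hγ _ x).trans ?_⟩
  rw [mul_assoc, ← integral_mul_const]
  refine mul_le_mul_of_nonneg_left (integral_mono_of_nonneg
    (Eventually.of_forall fun l => by positivity) (hi.mul_const _)
    (Eventually.of_forall fun l => ?_)) (by positivity)
  simp only
  rw [Module.End.pow_apply, FDunkl_schwartzDunkl_iterate hγ, norm_mul, norm_pow, norm_mul,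
    Complex.norm_I, one_mul, Complex.norm_real, Real.norm_eq_abs]
  by_cases hl : R < |l|
  · rw [hh l hl]; simp
  · push Not at hl
    calc |l| ^ m * ‖FDunkl γ h l‖ * |l| ^ (2 * γ) =
        ‖FDunkl γ h l‖ * |l| ^ (2 * γ) * |l| ^ m := by ring
      _ ≤ _ := by gcongr

lemma DunklBandLimited.abs_pow_mul_norm_iterate_le {γ R : ℝ} (hγ : 0 < γ) (hR : 1 ≤ R) (L : ℕ) :
    ∀ {h : 𝓢(ℝ, ℂ)}, DunklBandLimited γ R h → ∃ C, 0 ≤ C ∧ ∀ (m : ℕ) (x : ℝ),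
      |x| ^ L * ‖(schwartzDunkl γ ^ m) h x‖ ≤ C * ((m + 1 : ℝ) ^ L * R ^ m) := by
  induction L with
  | zero => intro h hh; simpa using hh.norm_iterate_le hγ
  | succ L ih =>
    intro h hh
    obtain ⟨C₁, hC₁, h₁⟩ := ih (hh.mulCoord hγ (by linarith))
    obtain ⟨C₂, hC₂, h₂⟩ := ih hh
    obtain ⟨C₃, hC₃, h₃⟩ := ih hh.reflect
    refine ⟨C₁ + C₂ + γ * 2 * C₃, by positivity, fun m x => ?_⟩
    cases m with
    | zero =>
      have := h₁ 0 x
      simp only [pow_zero, Module.End.one_apply, schwartzMulX_apply, norm_mul, Complex.norm_real,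
        Real.norm_eq_abs, Nat.cast_zero, zero_add, one_pow, mul_one] at this ⊢
      rw [pow_succ, mul_assoc]
      nlinarith [mul_nonneg hγ.le hC₃]
    | succ m =>
      have hx := congrArg (fun g : 𝓢(ℝ, ℂ) => ‖g x‖) (schwartzMulX_schwartzDunkl_iterate γ m h)
      simp only [schwartzMulX_apply, norm_mul, Complex.norm_real, Real.norm_eq_abs, sub_apply,
        smul_apply, smul_eq_mul] at hx
      set a := ‖(schwartzDunkl γ ^ (m + 1)) (schwartzMulX h) x‖
      set b := ‖(schwartzDunkl γ ^ m) h x‖ with hb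
      set d := ‖(schwartzDunkl γ ^ m) (schwartzRefl h) x‖ with hd
      have hle : |x| * ‖(schwartzDunkl γ ^ (m + 1)) h x‖ ≤ a + (m + 1) * b + γ * 2 * d := by
        rw [hx]
        refine (norm_sub_le _ _).trans (add_le_add ((norm_sub_le _ _).trans
          (add_le_add le_rfl ?_)) ?_)
        · rw [norm_mul, ← hb]
          gcongr
          exact_mod_cast (Complex.norm_natCast (m + 1)).le
        · rw [norm_mul, ← hd, norm_mul, Complex.norm_real, Real.norm_of_nonneg hγ.le]
          gcongr
          refine (norm_add_le _ _).trans ?_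
          rw [norm_pow, norm_neg, norm_one, one_pow]; norm_num
      have e₁ := h₁ (m + 1) x
      have e₂ := h₂ m x
      have e₃ := h₃ m x
      push_cast at e₁ ⊢
      have hm : (0 : ℝ) ≤ m := m.cast_nonneg
      have hp1 : (m + 1 : ℝ) ^ L * R ^ m ≤ (m + 1 + 1 : ℝ) ^ L * R ^ (m + 1) := by
        have := pow_le_pow_right₀ hR m.le_succ
        gcongr
        linarith
      set s := (m + 1 + 1 : ℝ) ^ L * R ^ (m + 1) with hs
      have hs0 : 0 ≤ s := by positivity
      calc |x| ^ (L + 1) * ‖(schwartzDunkl γ ^ (m + 1)) h x‖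
          = |x| ^ L * (|x| * ‖(schwartzDunkl γ ^ (m + 1)) h x‖) := by ring
        _ ≤ |x| ^ L * (a + (m + 1) * b + γ * 2 * d) := by gcongr
        _ = |x| ^ L * a + (m + 1) * (|x| ^ L * b) + γ * 2 * (|x| ^ L * d) := by ring
        _ ≤ C₁ * s + (m + 1) * (C₂ * s) + γ * 2 * (C₃ * s) :=
          add_le_add (add_le_add e₁ (mul_le_mul_of_nonneg_left
            (e₂.trans (mul_le_mul_of_nonneg_left hp1 hC₂)) (by positivity)))
            (mul_le_mul_of_nonneg_left (e₃.trans (mul_le_mul_of_nonneg_left hp1 hC₃))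
              (by positivity))
        _ ≤ (m + 1 + 1) * ((C₁ + C₂ + γ * 2 * C₃) * s) := by
          have p₁ : 0 ≤ (m + 1) * (C₁ * s) := by positivity
          have p₂ : 0 ≤ C₂ * s := by positivity
          have p₃ : 0 ≤ (m + 1) * (γ * 2 * (C₃ * s)) := by positivity
          linarith
        _ = _ := by rw [hs]; ring

lemma DunklBandLimited.abs_pow_mul_norm_iterate_le_pow {γ R : ℝ} (hγ : 0 < γ) (hR : 1 ≤ R) (L : ℕ)
    {h : 𝓢(ℝ, ℂ)} (hh : DunklBandLimited γ R h) : ∃ C, 0 ≤ C ∧ ∀ (m : ℕ) (x : ℝ),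
      |x| ^ L * ‖(schwartzDunkl γ ^ m) h x‖ ≤ C * (Real.exp 1 * R) ^ m := by
  obtain ⟨C, hC, h1⟩ := hh.abs_pow_mul_norm_iterate_le hγ hR L
  refine ⟨C * (L.factorial * Real.exp 1), by positivity, fun m x => (h1 m x).trans ?_⟩
  have h2 := Real.pow_div_factorial_le_exp (m + 1 : ℝ) (by positivity) L
  rw [div_le_iff₀ (by positivity), Real.exp_add, ← mul_one (m : ℝ), Real.exp_nat_mul,
    mul_one] at h2
  calc C * ((m + 1 : ℝ) ^ L * R ^ m)
      ≤ C * (Real.exp 1 ^ m * Real.exp 1 * L.factorial * R ^ m) := by gcongr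
    _ = _ := by rw [mul_pow]; ring

/-- The operator `Aop` on Schwartz functions. -/
def schwartzAop (γ : ℝ) (N : ℕ) (c : ℕ → ℝ) : Module.End ℂ 𝓢(ℝ, ℂ) :=
  ∑ j ∈ Finset.range (N + 1), ((c j : ℂ) * (-Complex.I) ^ j) • schwartzDunkl γ ^ j

lemma SchwartzMap.sum_smul_apply {ι : Type*} (s : Finset ι) (a : ι → ℂ) (g : ι → 𝓢(ℝ, ℂ)) (x : ℝ) :
    (∑ j ∈ s, a j • g j) x = ∑ j ∈ s, a j * g j x := by
  classical
  induction s using Finset.induction_on with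
  | empty => simp
  | insert i s hi ih => rw [Finset.sum_insert hi, Finset.sum_insert hi, add_apply, ih]; rfl

lemma schwartzAop_eq_sum (γ : ℝ) (N : ℕ) (c : ℕ → ℝ) (f : 𝓢(ℝ, ℂ)) :
    schwartzAop γ N c f = ∑ j ∈ Finset.range (N + 1),
      ((c j : ℂ) * (-Complex.I) ^ j) • (schwartzDunkl γ ^ j) f := by
  simp [schwartzAop, LinearMap.sum_apply]

lemma coe_schwartzAop (γ : ℝ) (N : ℕ) (c : ℕ → ℝ) (f : 𝓢(ℝ, ℂ)) :
    ⇑(schwartzAop γ N c f) = Aop γ N c f := by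
  ext x
  rw [schwartzAop_eq_sum, SchwartzMap.sum_smul_apply, Aop]
  simp only [Module.End.pow_apply, coe_schwartzDunkl_iterate]

lemma coe_schwartzAop_pow (γ : ℝ) (N : ℕ) (c : ℕ → ℝ) (n : ℕ) (f : 𝓢(ℝ, ℂ)) :
    ⇑((schwartzAop γ N c ^ n) f) = (Aop γ N c)^[n] f := by
  rw [Module.End.pow_apply]
  induction n generalizing f with
  | zero => rfl
  | succ n ih => rw [Function.iterate_succ_apply, Function.iterate_succ_apply, ih,
      coe_schwartzAop]

lemma FDunkl_sum_smul {γ : ℝ} (hγ : 0 < γ) {ι : Type*} (s : Finset ι) (a : ι → ℂ)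
    (g : ι → 𝓢(ℝ, ℂ)) (l : ℝ) :
    FDunkl γ (∑ j ∈ s, a j • g j : 𝓢(ℝ, ℂ)) l = ∑ j ∈ s, a j * FDunkl γ (g j) l := by
  simp only [FDunkl_eq, ← integral_const_mul]
  rw [← integral_finsetSum s fun j _ => ((g j).integrable_mul_dunklExp hγ l).const_mul (a j)]
  congr 1; ext x
  rw [SchwartzMap.sum_smul_apply, Finset.sum_mul, Finset.sum_mul]
  exact Finset.sum_congr rfl fun j _ => by ring

lemma FDunkl_schwartzAop {γ : ℝ} (hγ : 0 < γ) (N : ℕ) (c : ℕ → ℝ) (f : 𝓢(ℝ, ℂ)) (l : ℝ) :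
    FDunkl γ (schwartzAop γ N c f) l =
      ((∑ j ∈ Finset.range (N + 1), c j * l ^ j : ℝ) : ℂ) * FDunkl γ f l := by
  rw [schwartzAop_eq_sum, FDunkl_sum_smul hγ, Complex.ofReal_sum, Finset.sum_mul]
  refine Finset.sum_congr rfl fun j _ => ?_
  rw [Module.End.pow_apply, FDunkl_schwartzDunkl_iterate hγ, ← mul_assoc, mul_assoc (c j : ℂ),
    ← mul_pow, ← mul_assoc, neg_mul, Complex.I_mul_I]
  push_cast; ring

lemma FDunkl_schwartzAop_pow {γ : ℝ} (hγ : 0 < γ) (N : ℕ) (c : ℕ → ℝ) (n : ℕ) (f : 𝓢(ℝ, ℂ))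
    (l : ℝ) : FDunkl γ ((schwartzAop γ N c ^ n) f) l =
      ((∑ j ∈ Finset.range (N + 1), c j * l ^ j : ℝ) : ℂ) ^ n * FDunkl γ f l := by
  induction n with
  | zero => simp
  | succ n ih => rw [pow_succ', Module.End.mul_apply, FDunkl_schwartzAop hγ, ih]; ring

lemma norm_schwartzAop_pow_le {γ : ℝ} (hγ : 0 < γ) (N : ℕ) (c : ℕ → ℝ) (f : 𝓢(ℝ, ℂ)) {M : ℝ}
    (hM : ∀ l, FDunkl γ f l ≠ 0 → |∑ j ∈ Finset.range (N + 1), c j * l ^ j| ≤ M) :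
    ∃ C, 0 ≤ C ∧ ∀ (n : ℕ) (x : ℝ), ‖(schwartzAop γ N c ^ n) f x‖ ≤ C * M ^ n := by
  have hi := ((dunklDecay_FDunkl hγ f).integrable hγ (continuous_FDunkl hγ f).measurable).norm
  have hn : ∀ x : ℝ, ‖FDunkl γ f x * ((|x| ^ (2 * γ) : ℝ) : ℂ)‖ =
      ‖FDunkl γ f x‖ * |x| ^ (2 * γ) := fun x => by
    rw [norm_mul, Complex.norm_real, Real.norm_of_nonneg (by positivity)]
  simp only [hn] at hi
  refine ⟨‖FDunkl γ schwartzGaussian 0 ^ 2‖⁻¹ * ∫ l : ℝ, ‖FDunkl γ f l‖ * |l| ^ (2 * γ),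
    by positivity, fun n x => (norm_le_integral_norm_FDunkl hγ _ x).trans ?_⟩
  rw [mul_assoc, ← integral_mul_const]
  refine mul_le_mul_of_nonneg_left (integral_mono_of_nonneg
    (Eventually.of_forall fun l => by positivity) (hi.mul_const _)
    (Eventually.of_forall fun l => ?_)) (by positivity)
  simp only
  rw [FDunkl_schwartzAop_pow hγ, norm_mul, norm_pow, Complex.norm_real, Real.norm_eq_abs]
  by_cases hl : FDunkl γ f l = 0
  · rw [hl]; simp
  · calc |∑ j ∈ Finset.range (N + 1), c j * l ^ j| ^ n * ‖FDunkl γ f l‖ * |l| ^ (2 * γ) =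
        ‖FDunkl γ f l‖ * |l| ^ (2 * γ) * |∑ j ∈ Finset.range (N + 1), c j * l ^ j| ^ n := by ring
      _ ≤ _ := by have := hM l hl; gcongr

lemma DunklBandLimited.abs_pow_mul_norm_schwartzAop_pow_le {γ R : ℝ} (hγ : 0 < γ) (hR : 1 ≤ R)
    (L : ℕ) (N : ℕ) (c : ℕ → ℝ) {f : 𝓢(ℝ, ℂ)} (hf : DunklBandLimited γ R f) :
    ∃ C, 0 ≤ C ∧ ∀ (n : ℕ) (x : ℝ), |x| ^ L * ‖(schwartzAop γ N c ^ n) f x‖ ≤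
      C * (∑ j ∈ Finset.range (N + 1), |c j| * (Real.exp 1 * R) ^ j) ^ n := by
  obtain ⟨C, hC, h⟩ := hf.abs_pow_mul_norm_iterate_le_pow hγ hR L
  set r := Real.exp 1 * R
  have key : ∀ n m x, |x| ^ L * ‖(schwartzDunkl γ ^ m) ((schwartzAop γ N c ^ n) f) x‖ ≤
      C * (r ^ m * (∑ j ∈ Finset.range (N + 1), |c j| * r ^ j) ^ n) := by
    intro n
    induction n with
    | zero => intro m x; simpa using h m x
    | succ n ih =>
      intro m x
      have hcomm : (schwartzDunkl γ ^ m) ((schwartzAop γ N c ^ (n + 1)) f) =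
          ∑ j ∈ Finset.range (N + 1), ((c j : ℂ) * (-Complex.I) ^ j) •
            (schwartzDunkl γ ^ (m + j)) ((schwartzAop γ N c ^ n) f) := by
        rw [pow_succ', Module.End.mul_apply, schwartzAop_eq_sum, map_sum]
        refine Finset.sum_congr rfl fun j _ => ?_
        rw [map_smul, pow_add, Module.End.mul_apply]
      rw [hcomm, SchwartzMap.sum_smul_apply]
      calc |x| ^ L * ‖∑ j ∈ Finset.range (N + 1), ((c j : ℂ) * (-Complex.I) ^ j) *
            (schwartzDunkl γ ^ (m + j)) ((schwartzAop γ N c ^ n) f) x‖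
          ≤ |x| ^ L * ∑ j ∈ Finset.range (N + 1), |c j| *
            ‖(schwartzDunkl γ ^ (m + j)) ((schwartzAop γ N c ^ n) f) x‖ := by
            gcongr
            refine norm_sum_le_of_le _ fun j _ => ?_
            rw [norm_mul, norm_mul, norm_pow, norm_neg, Complex.norm_I, one_pow, mul_one,
              Complex.norm_real, Real.norm_eq_abs]
        _ = ∑ j ∈ Finset.range (N + 1), |c j| * (|x| ^ L *
            ‖(schwartzDunkl γ ^ (m + j)) ((schwartzAop γ N c ^ n) f) x‖) := by
            rw [Finset.mul_sum]
            exact Finset.sum_congr rfl fun j _ => by ring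
        _ ≤ ∑ j ∈ Finset.range (N + 1), |c j| * (C * (r ^ (m + j) *
              (∑ j ∈ Finset.range (N + 1), |c j| * r ^ j) ^ n)) :=
            Finset.sum_le_sum fun j _ => mul_le_mul_of_nonneg_left (ih _ _) (abs_nonneg _)
        _ = _ := by
            rw [pow_succ', Finset.sum_mul, Finset.mul_sum, Finset.mul_sum]
            exact Finset.sum_congr rfl fun j _ => by ring
  exact ⟨C, hC, fun n x => by simpa using key n 0 x⟩

/-- A polynomially weighted pointwise bound with the sharp exponential rate. -/
lemma DunklBandLimited.one_add_abs_pow_mul_norm_schwartzAop_pow_le {γ R : ℝ} (hγ : 0 < γ)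
    (hR : 1 ≤ R) (m : ℕ) (N : ℕ) (c : ℕ → ℝ) {f : 𝓢(ℝ, ℂ)} (hf : DunklBandLimited γ R f)
    {M M' : ℝ} (hM0 : 0 ≤ M) (hMM' : M < M')
    (hM : ∀ l, FDunkl γ f l ≠ 0 → |∑ j ∈ Finset.range (N + 1), c j * l ^ j| ≤ M) :
    ∃ C, 0 ≤ C ∧ ∀ (n : ℕ) (x : ℝ), ‖(schwartzAop γ N c ^ n) f x‖ * (1 + |x| ^ m) ≤ C * M' ^ n := by
  have hM' : 0 < M' := hM0.trans_lt hMM'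
  obtain ⟨C, hC, h⟩ := norm_schwartzAop_pow_le hγ N c f hM
  set B := ∑ j ∈ Finset.range (N + 1), |c j| * (Real.exp 1 * R) ^ j
  have hB : 0 ≤ B := by positivity
  obtain ⟨k, hk⟩ := exists_pow_lt_of_lt_one (show 0 < M' / (B + 1) by positivity)
    ((div_lt_one hM').2 hMM')
  have hk' : B * M ^ k ≤ M' ^ (k + 1) := by
    rw [div_pow, div_lt_div_iff₀ (by positivity) (by positivity)] at hk
    rw [pow_succ']
    nlinarith [pow_nonneg hM0 k]
  obtain ⟨D, hD, h'⟩ := hf.abs_pow_mul_norm_schwartzAop_pow_le hγ hR (m * (k + 1)) N c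
  set K := max 1 (D * C ^ k)
  have hK : 1 ≤ K := le_max_left _ _
  refine ⟨C + K, by positivity, fun n x => ?_⟩
  set a := ‖(schwartzAop γ N c ^ n) f x‖
  have ha : 0 ≤ a := norm_nonneg _
  have h1 : a ≤ C * M' ^ n := (h n x).trans (by gcongr)
  have h2 : |x| ^ m * a ≤ K * M' ^ n := by
    refine le_of_pow_le_pow_left₀ k.succ_ne_zero (by positivity) ?_
    calc (|x| ^ m * a) ^ (k + 1) = (|x| ^ (m * (k + 1)) * a) * a ^ k := by
          rw [mul_pow, ← pow_mul]; ring
      _ ≤ (D * B ^ n) * (C * M ^ n) ^ k :=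
          mul_le_mul (h' n x) (pow_le_pow_left₀ ha (h n x) k) (by positivity) (by positivity)
      _ = D * C ^ k * (B * M ^ k) ^ n := by ring
      _ ≤ K * (M' ^ (k + 1)) ^ n :=
          mul_le_mul (le_max_right _ _) (pow_le_pow_left₀ (by positivity) hk' n)
            (by positivity) (by positivity)
      _ ≤ K ^ (k + 1) * (M' ^ (k + 1)) ^ n := by
          gcongr
          exact le_self_pow₀ hK k.succ_ne_zero
      _ = (K * M' ^ n) ^ (k + 1) := by ring
  linarith

/-- The weighted measure `|x|^{2γ} dx`. -/
abbrev dunklMeasure (γ : ℝ) : Measure ℝ :=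
  volume.withDensity fun x : ℝ => ENNReal.ofReal (|x| ^ (2 * γ))

lemma eLpNorm_one_dunklMeasure {γ : ℝ} {f : ℝ → ℂ} (hf : Measurable f) :
    eLpNorm f 1 (dunklMeasure γ) = ∫⁻ x : ℝ, ‖f x * ((|x| ^ (2 * γ) : ℝ) : ℂ)‖ₑ := by
  have hW : Measurable fun x : ℝ => ENNReal.ofReal (|x| ^ (2 * γ)) := by fun_prop
  rw [eLpNorm_one_eq_lintegral_enorm, lintegral_withDensity_eq_lintegral_mul _ hW hf.enorm]
  congr 1; ext x
  rw [Pi.mul_apply, enorm_mul, mul_comm, ← ofReal_norm (_ : ℂ), ← ofReal_norm,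
    Complex.norm_real, Real.norm_of_nonneg (by positivity)]

lemma eLpNorm_lt_top_of_eLpNorm_one_of_bound {α : Type*} [MeasurableSpace α] {μ : Measure α}
    {f : α → ℂ} (hf : eLpNorm f 1 μ < ∞) (hfm : AEStronglyMeasurable f μ) {D : ℝ}
    (hD : ∀ x, ‖f x‖ ≤ D) {p : ℝ≥0∞} (hp : 1 ≤ p) : eLpNorm f p μ < ∞ := by
  by_cases hpt : p = ∞
  · rw [hpt]
    exact (memLp_top_of_bound hfm D (Eventually.of_forall hD)).2
  have hp1 : 1 ≤ p.toReal := by simpa using ENNReal.toReal_mono hpt hp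
  rw [eLpNorm_lt_top_iff_lintegral_rpow_enorm_lt_top (by positivity) hpt]
  rw [eLpNorm_one_eq_lintegral_enorm] at hf
  have hle : ∀ x, ‖f x‖ₑ ^ p.toReal ≤ ENNReal.ofReal D ^ (p.toReal - 1) * ‖f x‖ₑ := fun x => by
    calc ‖f x‖ₑ ^ p.toReal = ‖f x‖ₑ ^ (p.toReal - 1) * ‖f x‖ₑ ^ (1 : ℝ) := by
          rw [← ENNReal.rpow_add_of_nonneg _ _ (by linarith) zero_le_one, sub_add_cancel]
      _ ≤ _ := by
          rw [ENNReal.rpow_one]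
          gcongr
          rw [← ofReal_norm]; exact ENNReal.ofReal_le_ofReal (hD x)
  refine (lintegral_mono hle).trans_lt ?_
  have hfin : ENNReal.ofReal D ^ (p.toReal - 1) ≠ ∞ :=
    ENNReal.rpow_ne_top_of_nonneg (by linarith) ENNReal.ofReal_ne_top
  rw [lintegral_const_mul' _ _ hfin]
  exact ENNReal.mul_lt_top hfin.lt_top hf

lemma DunklDecay.eLpNorm_lt_top {γ : ℝ} (hγ : 0 < γ) {f : ℝ → ℂ} (hf : DunklDecay γ f)
    (hfm : Measurable f) {p : ℝ≥0∞} (hp : 1 ≤ p) : eLpNorm f p (dunklMeasure γ) < ∞ := by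
  obtain ⟨D, hD⟩ := hf.bounded
  refine eLpNorm_lt_top_of_eLpNorm_one_of_bound ?_ hfm.aestronglyMeasurable hD hp
  rw [eLpNorm_one_dunklMeasure hfm]
  exact (hf.integrable hγ hfm).2

/-- Fourier duality for the Dunkl transform. -/
lemma integral_FDunkl_mul {γ : ℝ} (hγ : 0 < γ) (f g : 𝓢(ℝ, ℂ)) :
    ∫ l : ℝ, FDunkl γ f l * g l * ((|l| ^ (2 * γ) : ℝ) : ℂ) =
      ∫ x : ℝ, f x * FDunkl γ g x * ((|x| ^ (2 * γ) : ℝ) : ℂ) := by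
  have hf := (f.dunklDecay γ).integrable hγ f.continuous.measurable
  have hg := (g.dunklDecay γ).integrable hγ g.continuous.measurable
  have hE : Measurable fun z : ℝ × ℝ => dunklExp γ (z.1 * z.2) :=
    ((continuous_dunklExp hγ).comp (continuous_fst.mul continuous_snd)).measurable
  have hint := (hg.mul_prod hf).mul_bdd hE.aestronglyMeasurable
    (Eventually.of_forall fun z => norm_dunklExp_le hγ _)
  have hswap := integral_integral_swap (f := fun l x => g l * ((|l| ^ (2 * γ) : ℝ) : ℂ) *
    (f x * ((|x| ^ (2 * γ) : ℝ) : ℂ)) * dunklExp γ (l * x)) hint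
  convert hswap using 1
  · congr 1; ext l
    rw [FDunkl_eq, mul_assoc, mul_comm, ← integral_const_mul]
    congr 1; ext x; ring
  · congr 1; ext x
    rw [FDunkl_eq, mul_assoc, mul_comm _ ((|x| ^ (2 * γ) : ℝ) : ℂ), ← mul_assoc,
      ← integral_const_mul]
    congr 1; ext l
    rw [mul_comm l x]; ring

lemma enorm_integral_mul_le {γ : ℝ} {f g : ℝ → ℂ} (hf : Measurable f) (hg : Measurable g)
    {p q : ℝ≥0∞} (hpq : p.HolderConjugate q) :
    ‖∫ x : ℝ, f x * g x * ((|x| ^ (2 * γ) : ℝ) : ℂ)‖ₑ ≤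
      eLpNorm f p (dunklMeasure γ) * eLpNorm g q (dunklMeasure γ) := by
  refine (enorm_integral_le_lintegral_enorm _).trans ?_
  rw [← eLpNorm_one_dunklMeasure (f := fun x => f x * g x) (hf.mul hg)]
  have h := eLpNorm_smul_le_mul_eLpNorm (μ := dunklMeasure γ) (r := 1) (p := p) (q := q)
    (f := g) (φ := f) hg.aestronglyMeasurable hf.aestronglyMeasurable
  exact h

lemma tendsto_ofReal_mul_pow_rpow {k : ℝ} (hk : 0 < k) {a : ℝ} (ha : 0 ≤ a) :
    Tendsto (fun n : ℕ => ENNReal.ofReal (k * a ^ n) ^ (1 / (n : ℝ))) atTop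
      (nhds (ENNReal.ofReal a)) := by
  have h1 : Tendsto (fun n : ℕ => ENNReal.ofReal (k ^ (1 / (n : ℝ)) * a)) atTop
      (nhds (ENNReal.ofReal (k ^ (0 : ℝ) * a))) :=
    ENNReal.tendsto_ofReal ((((Real.continuous_const_rpow hk.ne').tendsto 0).comp
      tendsto_one_div_atTop_nhds_zero_nat).mul_const a)
  rw [Real.rpow_zero, one_mul] at h1
  refine h1.congr' ?_
  filter_upwards [eventually_ne_atTop 0] with n hn
  rw [ENNReal.ofReal_rpow_of_nonneg (by positivity) (by positivity),
    Real.mul_rpow hk.le (by positivity), one_div, Real.pow_rpow_inv_natCast ha hn]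

lemma DunklBandLimited.eventually_eLpNorm_rpow_lt {γ R : ℝ} (hγ : 0 < γ) (hR : 1 ≤ R)
    (N : ℕ) (c : ℕ → ℝ) {f : 𝓢(ℝ, ℂ)} (hf : DunklBandLimited γ R f) {p : ℝ≥0∞} (hp : 1 ≤ p)
    {M : ℝ} (hM0 : 0 ≤ M)
    (hM : ∀ l, FDunkl γ f l ≠ 0 → |∑ j ∈ Finset.range (N + 1), c j * l ^ j| ≤ M)
    {b : ℝ≥0∞} (hb : ENNReal.ofReal M < b) :
    ∀ᶠ n : ℕ in atTop,
      eLpNorm ((schwartzAop γ N c ^ n) f) p (dunklMeasure γ) ^ (1 / (n : ℝ)) < b := by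
  obtain ⟨M', hMM', hM'b⟩ : ∃ M' : ℝ, M < M' ∧ ENNReal.ofReal M' < b := by
    obtain ⟨r, hr, hrb⟩ := ENNReal.lt_iff_exists_nnreal_btwn.1 hb
    refine ⟨r, ?_, by simpa using hrb⟩
    rwa [ENNReal.ofReal, ENNReal.coe_lt_coe, Real.toNNReal_lt_iff_lt_coe hM0] at hr
  have hM'0 := hM0.trans hMM'.le
  obtain ⟨C, hC, h⟩ := hf.one_add_abs_pow_mul_norm_schwartzAop_pow_le hγ hR (dunklExponent γ)
    N c hM0 hMM' hM
  set w : ℝ → ℂ := fun x => (((1 + |x| ^ dunklExponent γ)⁻¹ : ℝ) : ℂ) with hw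
  have hwn : ∀ x, ‖w x‖ = (1 + |x| ^ dunklExponent γ)⁻¹ := fun x => by
    rw [hw, Complex.norm_real, Real.norm_of_nonneg (by positivity)]
  have hwd : DunklDecay γ w := ⟨1, fun x => by
    rw [hwn, inv_mul_cancel₀ (by positivity)]⟩
  have hwt := hwd.eLpNorm_lt_top hγ (by fun_prop) hp
  set V := eLpNorm w p (dunklMeasure γ)
  have hle : ∀ n, eLpNorm ((schwartzAop γ N c ^ n) f) p (dunklMeasure γ) ≤
      ENNReal.ofReal (((C + 1) * (V.toReal + 1)) * M' ^ n) := fun n => by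
    refine (eLpNorm_le_mul_eLpNorm_of_ae_le_mul (g := w) (c := C * M' ^ n)
      (Eventually.of_forall fun x => ?_) p).trans ?_
    · rw [hwn, ← div_eq_mul_inv, le_div_iff₀ (by positivity)]
      exact h n x
    · have hV : V = ENNReal.ofReal V.toReal := (ENNReal.ofReal_toReal hwt.ne).symm
      change _ * V ≤ _
      nth_rewrite 1 [hV]
      rw [← ENNReal.ofReal_mul (by positivity)]
      refine ENNReal.ofReal_le_ofReal ?_
      rw [mul_right_comm]
      have : 0 ≤ V.toReal := ENNReal.toReal_nonneg
      gcongr <;> linarith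
  have hpos : 0 < (C + 1) * (V.toReal + 1) := by
    have : 0 ≤ V.toReal := ENNReal.toReal_nonneg
    positivity
  filter_upwards [(tendsto_ofReal_mul_pow_rpow hpos hM'0).eventually_lt_const hM'b] with n hn
  exact (ENNReal.rpow_le_rpow (hle n) (by positivity)).trans_lt hn

lemma eventually_lt_eLpNorm_rpow {γ : ℝ} (hγ : 0 < γ) (N : ℕ) (c : ℕ → ℝ) (f : 𝓢(ℝ, ℂ))
    {p : ℝ≥0∞} (hp : 1 ≤ p) {a : ℝ} (ha : 0 ≤ a) {l : ℝ} (hl : l ∈ tsupport (FDunkl γ f))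
    (hal : a < |∑ j ∈ Finset.range (N + 1), c j * l ^ j|) {b : ℝ≥0∞} (hb : b < ENNReal.ofReal a) :
    ∀ᶠ n : ℕ in atTop,
      b < eLpNorm ((schwartzAop γ N c ^ n) f) p (dunklMeasure γ) ^ (1 / (n : ℝ)) := by
  set P : ℝ → ℝ := fun l => ∑ j ∈ Finset.range (N + 1), c j * l ^ j
  have hPc : Continuous P := by fun_prop
  set F := FDunkl γ f
  have hFc : Continuous F := continuous_FDunkl hγ f
  obtain ⟨l₁, hl₁P, hl₁F⟩ := mem_closure_iff.1 hl _
    (isOpen_lt continuous_const (continuous_abs.comp hPc)) hal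
  have hopen : IsOpen ({l | a < |P l|} ∩ Function.support F) :=
    (isOpen_lt continuous_const (continuous_abs.comp hPc)).inter
      (isOpen_ne_fun hFc continuous_const)
  obtain ⟨l₀, ⟨hP₀, hF₀⟩, hl₀⟩ := (dense_compl_singleton (0 : ℝ)).inter_open_nonempty _ hopen
    ⟨l₁, hl₁P, hl₁F⟩
  obtain ⟨s, hs1, hsP⟩ : ∃ s : ℝ, |s| = 1 ∧ s * P l₀ = |P l₀| := by
    rcases abs_cases (P l₀) with h | h
    · exact ⟨1, by simp, by rw [h.1, one_mul]⟩
    · exact ⟨-1, by simp, by rw [h.1, neg_one_mul]⟩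
  have hE : {l | a < s * P l} ∩ {l | 0 < (F l * (starRingEnd ℂ) (F l₀)).re} ∈ nhds l₀ := by
    refine ((isOpen_lt continuous_const (by fun_prop)).inter
      (isOpen_lt continuous_const (by fun_prop))).mem_nhds ⟨?_, ?_⟩
    · simpa [hsP] using hP₀
    · change 0 < (F l₀ * (starRingEnd ℂ) (F l₀)).re
      rw [Complex.mul_conj, Complex.ofReal_re]
      exact Complex.normSq_pos.2 hF₀
  obtain ⟨β, hβs, hβc, hβd, hβr, hβ1⟩ := exists_contDiff_tsupport_subset (n := ⊤) hE
  have hβ0 : ∀ x, 0 ≤ β x := fun x => (hβr ⟨x, rfl⟩).1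
  have hβE : ∀ x, β x ≠ 0 → a < s * P x ∧ 0 < (F x * (starRingEnd ℂ) (F l₀)).re := fun x hx =>
    hβs (subset_tsupport _ hx)
  have hφc : HasCompactSupport fun x => (starRingEnd ℂ) (F l₀) * (β x : ℂ) :=
    (hβc.comp_left (g := fun t : ℝ => (t : ℂ)) Complex.ofReal_zero).mul_left
  set φ : 𝓢(ℝ, ℂ) := hφc.toSchwartzMap
    (contDiff_const.mul (Complex.ofRealCLM.contDiff.comp hβd))
  have hφ : ∀ x, φ x = (starRingEnd ℂ) (F l₀) * (β x : ℂ) := fun x => rfl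
  set G : ℝ → ℝ := fun x => (F x * φ x * ((|x| ^ (2 * γ) : ℝ) : ℂ)).re
  have hG : ∀ x, G x = (F x * (starRingEnd ℂ) (F l₀)).re * β x * |x| ^ (2 * γ) := fun x => by
    change (F x * φ x * ((|x| ^ (2 * γ) : ℝ) : ℂ)).re = _
    rw [hφ, ← mul_assoc, Complex.re_mul_ofReal, Complex.re_mul_ofReal]
  have hG0 : ∀ x, 0 ≤ G x := fun x => by
    rw [hG]
    by_cases hx : β x = 0
    · simp [hx]
    · have := (hβE x hx).2.le
      have := hβ0 x
      positivity
  have hint : ∀ n, Integrable fun x : ℝ =>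
      FDunkl γ ((schwartzAop γ N c ^ n) f) x * φ x * ((|x| ^ (2 * γ) : ℝ) : ℂ) := fun n => by
    obtain ⟨D, hD⟩ := (φ.dunklDecay γ).bounded
    exact (dunklDecay_FDunkl hγ _).integrable_mul hγ (continuous_FDunkl hγ _).measurable
      φ.continuous.measurable hD
  have hGi : Integrable G := (hint 0).re
  have hGpos : 0 < ∫ x, G x := by
    refine integral_pos_of_integrable_nonneg_nonzero (x := l₀) ?_ hGi hG0 ?_
    · exact Complex.continuous_re.comp
        ((hFc.mul φ.continuous).mul (continuous_dunklWeight hγ))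
    · rw [hG, hβ1]
      have h1 := (hβE l₀ (by rw [hβ1]; exact one_ne_zero)).2
      have h2 : 0 < |l₀| := abs_pos.2 hl₀
      positivity
  set k := ∫ x, G x
  have hlow : ∀ n, k * a ^ n ≤
      ‖∫ x : ℝ, FDunkl γ ((schwartzAop γ N c ^ n) f) x * φ x * ((|x| ^ (2 * γ) : ℝ) : ℂ)‖ := by
    intro n
    set I := ∫ x : ℝ, FDunkl γ ((schwartzAop γ N c ^ n) f) x * φ x * ((|x| ^ (2 * γ) : ℝ) : ℂ)
    have hsI : ‖I‖ = ‖(s : ℂ) ^ n * I‖ := by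
      rw [norm_mul, norm_pow, Complex.norm_real, Real.norm_eq_abs, hs1, one_pow, one_mul]
    have hfun : ∀ x, ((s : ℂ) ^ n * (FDunkl γ ((schwartzAop γ N c ^ n) f) x * φ x *
        ((|x| ^ (2 * γ) : ℝ) : ℂ))).re = (s * P x) ^ n * G x := fun x => by
      have h : (s : ℂ) ^ n * (FDunkl γ ((schwartzAop γ N c ^ n) f) x * φ x *
          ((|x| ^ (2 * γ) : ℝ) : ℂ)) =
          (((s * P x) ^ n : ℝ) : ℂ) * (F x * φ x * ((|x| ^ (2 * γ) : ℝ) : ℂ)) := by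
        rw [FDunkl_schwartzAop_pow hγ]
        simp only [P, F]
        push_cast
        ring
      rw [h, Complex.re_ofReal_mul]
    have hsint := ((hint n).const_mul ((s : ℂ) ^ n)).re
    have hre : ((s : ℂ) ^ n * I).re = ∫ x, (s * P x) ^ n * G x := by
      rw [← integral_const_mul, ← integral_congr_ae (ae_of_all _ hfun)]
      exact (integral_re ((hint n).const_mul _)).symm
    rw [hsI]
    refine le_trans ?_ (Complex.re_le_norm _)
    rw [hre, mul_comm, ← integral_const_mul]
    refine integral_mono (hGi.const_mul _) (hsint.congr (ae_of_all _ hfun)) fun x => ?_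
    by_cases hx : β x = 0
    · simp [hG, hx]
    · have := hG0 x
      have := (hβE x hx).1.le
      gcongr
  obtain ⟨q, hpq, hq⟩ : ∃ q, p.HolderConjugate q ∧ 1 ≤ q :=
    ⟨_, .conjExponent hp, le_self_add⟩
  have hV := (dunklDecay_FDunkl hγ φ).eLpNorm_lt_top hγ (continuous_FDunkl hγ φ).measurable hq
  set V := eLpNorm (FDunkl γ φ) q (dunklMeasure γ)
  have hV0 : 0 ≤ V.toReal := ENNReal.toReal_nonneg
  have hle : ∀ n, ENNReal.ofReal (k / (V.toReal + 1) * a ^ n) ≤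
      eLpNorm ((schwartzAop γ N c ^ n) f) p (dunklMeasure γ) := fun n => by
    have h1 := enorm_integral_mul_le (γ := γ) ((schwartzAop γ N c ^ n) f).continuous.measurable
      (continuous_FDunkl hγ φ).measurable hpq
    rw [← integral_FDunkl_mul hγ, ← ofReal_norm] at h1
    have h2 : V ≤ ENNReal.ofReal (V.toReal + 1) := by
      rw [← ENNReal.ofReal_toReal hV.ne]
      exact ENNReal.ofReal_le_ofReal (by rw [ENNReal.toReal_ofReal hV0]; linarith)
    have h3 := ((ENNReal.ofReal_le_ofReal (hlow n)).trans h1).trans (mul_le_mul_right h2 _)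
    rw [div_mul_eq_mul_div, ENNReal.ofReal_div_of_pos (by positivity)]
    exact ENNReal.div_le_of_le_mul h3
  have hpos : 0 < k / (V.toReal + 1) := by positivity
  filter_upwards [(tendsto_ofReal_mul_pow_rpow hpos ha).eventually_const_lt hb] with n hn
  exact hn.trans_le (ENNReal.rpow_le_rpow (hle n) (by positivity))

lemma exists_forall_lt_abs_sum {N : ℕ} {c : ℕ → ℝ} (hP : ∃ j, j ≠ 0 ∧ j ≤ N ∧ c j ≠ 0) (M : ℝ) :
    ∃ R, 1 ≤ R ∧ ∀ l : ℝ, R < |l| → M < |∑ j ∈ Finset.range (N + 1), c j * l ^ j| := by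
  obtain ⟨i, hi0, hiN, hci⟩ := hP
  set q : Polynomial ℝ := ∑ j ∈ Finset.range (N + 1), Polynomial.C (c j) * Polynomial.X ^ j
  have heval : ∀ l, q.eval l = ∑ j ∈ Finset.range (N + 1), c j * l ^ j := fun l => by
    simp [q, Polynomial.eval_finsetSum]
  have hcoeff : q.coeff i = c i := by
    simp only [q, Polynomial.finsetSum_coeff, Polynomial.coeff_C_mul_X_pow]
    rw [Finset.sum_ite_eq, if_pos (Finset.mem_range.2 (by lia))]
  have hdeg : 0 < q.degree := by
    refine lt_of_lt_of_le ?_ (Polynomial.le_degree_of_ne_zero (hcoeff ▸ hci))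
    exact_mod_cast Nat.pos_of_ne_zero hi0
  have h := q.tendsto_norm_atTop hdeg (l := comap norm atTop) (z := fun x : ℝ => x) tendsto_comap
  obtain ⟨R, -, hR⟩ := ((atTop_basis.comap _).eventually_iff).1 (h.eventually_gt_atTop M)
  refine ⟨max 1 R, le_max_left _ _, fun l hl => ?_⟩
  rw [← heval]
  exact hR (show R ≤ ‖l‖ from (le_max_right 1 R).trans hl.le)

theorem stmt14 (γ : ℝ) (hγ : 0 < γ) (f : 𝓢(ℝ, ℂ)) (N : ℕ) (c : ℕ → ℝ)
    (hP : ∃ j, j ≠ 0 ∧ j ≤ N ∧ c j ≠ 0) (p : ℝ≥0∞) (hp : 1 ≤ p) :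
    Tendsto (fun n : ℕ =>
        (eLpNorm ((Aop γ N c)^[n] ⇑f) p
          (volume.withDensity fun x : ℝ => ENNReal.ofReal (|x| ^ (2 * γ)))) ^ (1 / (n : ℝ)))
      atTop
      (nhds (⨆ lam ∈ tsupport (FDunkl γ ⇑f),
        ENNReal.ofReal |∑ j ∈ Finset.range (N + 1), c j * lam ^ j|)) := by
  simp only [← coe_schwartzAop_pow]
  refine tendsto_order.2 ⟨fun b hb => ?_, fun b hb => ?_⟩
  · simp only [lt_iSup_iff] at hb
    obtain ⟨l, hl, hbl⟩ := hb
    obtain ⟨a, hba, hal⟩ := ENNReal.lt_iff_exists_nnreal_btwn.1 hbl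
    refine eventually_lt_eLpNorm_rpow hγ N c f hp a.coe_nonneg hl ?_ (by simpa using hba)
    rwa [← ENNReal.ofReal_coe_nnreal, ENNReal.ofReal_lt_ofReal_iff_of_nonneg a.coe_nonneg] at hal
  · set S := ⨆ lam ∈ tsupport (FDunkl γ ⇑f),
      ENNReal.ofReal |∑ j ∈ Finset.range (N + 1), c j * lam ^ j|
    have hS : S ≠ ∞ := hb.ne_top
    have hM : ∀ l, FDunkl γ f l ≠ 0 →
        |∑ j ∈ Finset.range (N + 1), c j * l ^ j| ≤ S.toReal := fun l hl => by
      rw [← ENNReal.ofReal_le_iff_le_toReal hS]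
      exact le_iSup₂_of_le l (subset_tsupport _ hl) le_rfl
    obtain ⟨R, hR, hRM⟩ := exists_forall_lt_abs_sum hP S.toReal
    have hf : DunklBandLimited γ R f := fun l hl => by
      by_contra h
      exact absurd (hM l h) (hRM l hl).not_ge
    exact hf.eventually_eLpNorm_rpow_lt hγ hR N c hp ENNReal.toReal_nonneg hM
      (by rwa [ENNReal.ofReal_toReal hS])
end
end
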